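/- arXiv:1509.02829 — 2 statements merged into one kernel-verified Lean document; each statement's English description precedes it below -/
import Mathlib

section
/- Let A ⊆ ℕ = {1,2,…} with 1 ∈ A. For every n ≥ 1, the number of noncrossing trees with n vertices all of whose vertex degrees belong to A equals Σ_{τ ∈ T_n^A} ∏_{u ∈ τ∖{∅}} (k_u(τ) + 1), where T_n^A is the set of plane trees with n vertices such that the root has k_∅(τ) ∈ A children and every non-root vertex u satisfies k_u(τ) + 1 ∈ A. -/
open Filter Set

noncomputable section

/-- The position `e^{-2iπk/n}` of the `k`-th among the `n`-th roots of unity,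
labelled in clockwise order starting from the complex number `1`. -/
def ncPos (n k : ℕ) : ℂ := Complex.exp (-(2 * Real.pi * Complex.I) * k / n)

/-- A noncrossing tree with `n` vertices: a tree on the vertex set of `n`-th roots of unity
whose edges, drawn as straight line segments, pairwise intersect only at common endpoints. -/
structure NCTree (n : ℕ) where
  adj : SimpleGraph (Fin n)
  isTree : adj.IsTree
  noncrossing : ∀ a b c d : Fin n, adj.Adj a b → adj.Adj c d →
    ({(a : ℕ), (b : ℕ)} : Set ℕ) ≠ {(c : ℕ), (d : ℕ)} →
    segment ℝ (ncPos n a) (ncPos n b) ∩ segment ℝ (ncPos n c) (ncPos n d) ⊆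
      {z : ℂ | (z = ncPos n a ∨ z = ncPos n b) ∧ (z = ncPos n c ∨ z = ncPos n d)}

/-- A plane tree in Neveu's formalism: a finite set of finite words of positive integers,
containing the root `[]`, closed under prefixes, and such that the children of a vertex `u`
are `u1, …, u k_u`. -/
structure PlaneTree where
  verts : Finset (List ℕ)
  root_mem : [] ∈ verts
  prefix_closed : ∀ u v : List ℕ, u <+: v → v ∈ verts → u ∈ verts
  labels_pos : ∀ u ∈ verts, ∀ i ∈ u, 1 ≤ i
  children_closed : ∀ (u : List ℕ) (i : ℕ), 1 ≤ i → u ++ [i + 1] ∈ verts → u ++ [i] ∈ verts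

namespace PlaneTree

/-- The number of children of the vertex `u` in `τ`. -/
def kc (τ : PlaneTree) (u : List ℕ) : ℕ := Set.ncard {i : ℕ | u ++ [i] ∈ τ.verts}

/-- The number of strict descendants of `u` in `τ`. -/
def descCount (τ : PlaneTree) (u : List ℕ) : ℕ :=
  Set.ncard {v : List ℕ | v ∈ τ.verts ∧ u <+: v ∧ v ≠ u}

/-- The number of vertices of the subtree grafted on `u` (that is, `u` and its descendants). -/
def subtreeSize (τ : PlaneTree) (u : List ℕ) : ℕ :=
  Set.ncard {v : List ℕ | v ∈ τ.verts ∧ u <+: v}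

/-- The height of `τ`: the maximal generation of a vertex. -/
def height (τ : PlaneTree) : ℕ := τ.verts.sup List.length

/-- The `j`-th vertex of `τ` in lexicographical order (starting from `j = 0` for the root). -/
def lexVertex (τ : PlaneTree) (j : ℕ) : List ℕ := (τ.verts.sort (· ≤ ·)).getD j []

/-- The Łukasiewicz path of `τ`: `W 0 = 0` and `W (j+1) = W j + k_{u(j)} - 1`, the vertices
being listed in lexicographical order. -/
def lukas (τ : PlaneTree) (j : ℕ) : ℤ :=
  (((τ.verts.sort (· ≤ ·)).take j).map fun u => (τ.kc u : ℤ) - 1).sum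

end PlaneTree

/-- `IsShape n θ τ f` expresses that the plane tree `τ` is the shape of the noncrossing tree
`θ`, the correspondence between the vertices of `τ` and those of `θ` being given by `f`:
`f` is a bijection sending the root of `τ` to the vertex `1` of `θ`, sending parent-child
pairs exactly to edges of `θ`, and the planar (clockwise, starting from the parent) order of
the children of each vertex agrees with their order in `τ`. -/
def IsShape (n : ℕ) (θ : NCTree n) (τ : PlaneTree) (f : List ℕ → Fin n) : Prop :=
  τ.verts.card = n ∧
  Set.BijOn f (↑τ.verts) Set.univ ∧
  (f ([] : List ℕ)).val = 0 ∧
  (∀ u ∈ τ.verts, u ≠ [] → θ.adj.Adj (f u.dropLast) (f u)) ∧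
  (∀ u ∈ τ.verts, ∀ v ∈ τ.verts, θ.adj.Adj (f u) (f v) → u = v.dropLast ∨ v = u.dropLast) ∧
  (∀ u ∈ τ.verts, ∀ i j : ℕ, 1 ≤ i → i < j → u ++ [j] ∈ τ.verts →
    f (u ++ [i]) - f u.dropLast < f (u ++ [j]) - f u.dropLast)

/-- `leftOf z w` : the point `w` lies in the (open) left half-plane bounded by the oriented
line from `z` to the complex number `1`. -/
def leftOf (z w : ℂ) : Prop := 0 < ((starRingEnd ℂ) (1 - z) * (w - z)).im

/-- The number of children of the vertex of `θ` corresponding to the vertex `u` of its shape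
`τ` which lie to the left of it (in the left half-plane bounded by the line joining it to the
complex number `1`). -/
def leftCount (n : ℕ) (θ : NCTree n) (τ : PlaneTree) (f : List ℕ → Fin n) (u : List ℕ) : ℕ :=
  Set.ncard {i : ℕ | u ++ [i] ∈ τ.verts ∧ leftOf (ncPos n (f u)) (ncPos n (f (u ++ [i])))}

/-- The degree of the vertex `v` in the noncrossing tree `θ`. -/
def ncDeg (n : ℕ) (θ : NCTree n) (v : Fin n) : ℕ := Set.ncard {w : Fin n | θ.adj.Adj v w}

/-- The noncrossing tree `θ` viewed as the compact subset of the closed unit disk given by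
the union of its edges. -/
def ncSet (n : ℕ) (θ : NCTree n) : Set ℂ :=
  ⋃ (a : Fin n) (b : Fin n) (_ : θ.adj.Adj a b), segment ℝ (ncPos n a) (ncPos n b)

end

namespace NCProof

/-- Forests of butterflies, encoded as ternary trees: first butterfly (left part, right part),
then the rest of the forest. -/
inductive Fo where
  | nil : Fo
  | cons : Fo → Fo → Fo → Fo

open Relation

def sz : Fo → ℕ
  | Fo.nil => 0
  | Fo.cons L R T => sz L + sz R + sz T + 1

def ln : Fo → ℕ
  | Fo.nil => 0
  | Fo.cons _ _ T => ln T + 1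

/-- Directed (parent, child) edges of the forest placed on `[s, s + sz F)` with parent `p`. -/
def Ed : Fo → ℕ → ℕ → ℕ → ℕ → Prop
  | Fo.nil, _, _, _, _ => False
  | Fo.cons L R T, s, p, x, y => (x = p ∧ y = s + sz L) ∨ Ed L s (s + sz L) x y ∨
      Ed R (s + sz L + 1) (s + sz L) x y ∨ Ed T (s + sz L + 1 + sz R) p x y

def Ad (F : Fo) (s p x y : ℕ) : Prop := Ed F s p x y ∨ Ed F s p y x

def Dg (A : Set ℕ) : Fo → Prop
  | Fo.nil => True
  | Fo.cons L R T => ln L + ln R + 1 ∈ A ∧ Dg A L ∧ Dg A R ∧ Dg A T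

theorem Ad.symm {F s p x y} (h : Ad F s p x y) : Ad F s p y x := Or.symm h

theorem supp {F : Fo} : ∀ {s p x y : ℕ}, Ed F s p x y →
    (s ≤ y ∧ y < s + sz F) ∧ (x = p ∨ (s ≤ x ∧ x < s + sz F)) := by
  induction F with
  | nil => intro s p x y h; exact h.elim
  | cons L R T hL hR hT =>
    intro s p x y h
    simp only [sz]
    rcases h with h | h | h | h
    · omega
    · have := hL h; omega
    · have := hR h; omega
    · have := hT h; omega

theorem suppA {F : Fo} {s p x y : ℕ} (h : Ad F s p x y) :
    (x = p ∨ (s ≤ x ∧ x < s + sz F)) ∧ (y = p ∨ (s ≤ y ∧ y < s + sz F)) := by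
  rcases h with h | h <;> have := supp h <;> omega

theorem Ed_ne {F : Fo} : ∀ {s p x y : ℕ}, (p < s ∨ s + sz F ≤ p) → Ed F s p x y → x ≠ y := by
  induction F with
  | nil => intro s p x y _ h; exact h.elim
  | cons L R T hL hR hT =>
    intro s p x y ho h
    simp only [sz] at ho
    rcases h with h | h | h | h
    · omega
    · exact hL (by omega) h
    · exact hR (by omega) h
    · exact hT (by omega) h

theorem Ad_cons {L R T : Fo} {s p x y : ℕ} : Ad (Fo.cons L R T) s p x y ↔
    ((x = p ∧ y = s + sz L) ∨ (y = p ∧ x = s + sz L)) ∨ Ad L s (s + sz L) x y ∨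
      Ad R (s + sz L + 1) (s + sz L) x y ∨ Ad T (s + sz L + 1 + sz R) p x y := by
  simp only [Ad, Ed]; tauto

theorem Ad_L {L R T : Fo} {s p x y : ℕ} (ho : p < s ∨ s + sz (Fo.cons L R T) ≤ p) :
    Ad L s (s + sz L) x y ↔ Ad (Fo.cons L R T) s p x y ∧ (s ≤ x ∧ x ≤ s + sz L) ∧
      (s ≤ y ∧ y ≤ s + sz L) := by
  simp only [sz] at ho
  constructor
  · intro h
    have := suppA h
    exact ⟨Ad_cons.2 (by tauto), by omega, by omega⟩
  · rintro ⟨h, h1, h2⟩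
    rcases Ad_cons.1 h with h | h | (h | h) | (h | h)
    · omega
    · exact h
    all_goals have := supp h; omega

theorem Ad_R {L R T : Fo} {s p x y : ℕ} (ho : p < s ∨ s + sz (Fo.cons L R T) ≤ p) :
    Ad R (s + sz L + 1) (s + sz L) x y ↔ Ad (Fo.cons L R T) s p x y ∧
      (s + sz L ≤ x ∧ x < s + sz L + 1 + sz R) ∧
      (s + sz L ≤ y ∧ y < s + sz L + 1 + sz R) := by
  simp only [sz] at ho
  constructor
  · intro h
    have := suppA h
    exact ⟨Ad_cons.2 (by tauto), by omega, by omega⟩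
  · rintro ⟨h, h1, h2⟩
    rcases Ad_cons.1 h with h | (h | h) | h | (h | h)
    · omega
    · have := supp h; omega
    · have := supp h; omega
    · exact h
    all_goals have := supp h; omega

theorem Ad_T {L R T : Fo} {s p x y : ℕ} (ho : p < s ∨ s + sz (Fo.cons L R T) ≤ p) :
    Ad T (s + sz L + 1 + sz R) p x y ↔ Ad (Fo.cons L R T) s p x y ∧
      (x = p ∨ s + sz L + 1 + sz R ≤ x) ∧
      (y = p ∨ s + sz L + 1 + sz R ≤ y) := by
  simp only [sz] at ho
  constructor
  · intro h
    have := suppA h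
    exact ⟨Ad_cons.2 (by tauto), by omega, by omega⟩
  · rintro ⟨h, h1, h2⟩
    rcases Ad_cons.1 h with h | (h | h) | (h | h) | h
    · omega
    · have := supp h; omega
    · have := supp h; omega
    · have := supp h; omega
    · have := supp h; omega
    · exact h

theorem Ad_nc {F : Fo} : ∀ {s p a b c d : ℕ}, (p < s ∨ s + sz F ≤ p) → Ad F s p a b →
    Ad F s p c d → ¬ (a < c ∧ c < b ∧ b < d) := by
  induction F with
  | nil => intro s p a b c d _ h; exact (h.elim id id).elim
  | cons L R T hL hR hT =>
    intro s p a b c d ho h h'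
    simp only [sz] at ho
    rcases Ad_cons.1 h with h | h | h | h <;> rcases Ad_cons.1 h' with h' | h' | h' | h'
    · omega
    · have := suppA h'; omega
    · have := suppA h'; omega
    · have := suppA h'; omega
    · have := suppA h; omega
    · exact hL (by omega) h h'
    · have := suppA h; have := suppA h'; omega
    · have := suppA h; have := suppA h'; omega
    · have := suppA h; omega
    · have := suppA h; have := suppA h'; omega
    · exact hR (by omega) h h'
    · have := suppA h; have := suppA h'; omega
    · have := suppA h; omega
    · have := suppA h; have := suppA h'; omega
    · have := suppA h; have := suppA h'; omega
    · exact hT (by omega) h h'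

theorem rtg_mono {α : Type*} {r r' : α → α → Prop} {a b : α} (hr : ∀ a b, r a b → r' a b)
    (h : ReflTransGen r a b) : ReflTransGen r' a b := by
  induction h with
  | refl => exact ReflTransGen.refl
  | tail _ h2 ih => exact ih.tail (hr _ _ h2)

theorem Ad_reach {F : Fo} : ∀ {s p x : ℕ}, s ≤ x → x < s + sz F →
    ReflTransGen (Ad F s p) x p := by
  induction F with
  | nil => intro s p x h h'; simp [sz] at h'; omega
  | cons L R T hL hR hT =>
    intro s p x h h'
    have hc : ReflTransGen (Ad (Fo.cons L R T) s p) (s + sz L) p :=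
      ReflTransGen.single (Ad_cons.2 (by tauto))
    simp only [sz] at h'
    rcases lt_trichotomy x (s + sz L) with h1 | h1 | h1
    · refine ReflTransGen.trans (rtg_mono ?_ (hL (p := s + sz L) h h1)) hc
      intro a b hab; exact Ad_cons.2 (by tauto)
    · rw [h1]; exact hc
    · by_cases h2 : x < s + sz L + 1 + sz R
      · refine ReflTransGen.trans (rtg_mono ?_ (hR (p := s + sz L) h1 h2)) hc
        intro a b hab; exact Ad_cons.2 (by tauto)
      · refine (rtg_mono ?_ (hT (p := p) (s := s + sz L + 1 + sz R) (x := x) (by omega) (by omega)))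
        intro a b hab; exact Ad_cons.2 (by tauto)

theorem Ed_card {F : Fo} : ∀ (s p : ℕ), {q : ℕ × ℕ | Ed F s p q.1 q.2}.encard ≤ sz F := by
  induction F with
  | nil => intro s p; simp [Ed, sz]
  | cons L R T hL hR hT =>
    intro s p
    have : {q : ℕ × ℕ | Ed (Fo.cons L R T) s p q.1 q.2} = ({(p, s + sz L)} : Set (ℕ × ℕ)) ∪
        ({q : ℕ × ℕ | Ed L s (s + sz L) q.1 q.2} ∪
        ({q : ℕ × ℕ | Ed R (s + sz L + 1) (s + sz L) q.1 q.2} ∪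
        {q : ℕ × ℕ | Ed T (s + sz L + 1 + sz R) p q.1 q.2})) := by
      ext ⟨a, b⟩
      simp [Ed]
    rw [this]
    calc _ ≤ (1 : ℕ∞) + (sz L + (sz R + sz T)) := by
          refine (Set.encard_union_le _ _).trans (add_le_add (by simp) ?_)
          refine (Set.encard_union_le _ _).trans (add_le_add (hL _ _) ?_)
          exact (Set.encard_union_le _ _).trans (add_le_add (hR _ _) (hT _ _))
      _ = _ := by simp only [sz]; push_cast; ring

theorem exit_lemma {α : Type*} {r : α → α → Prop} {Q : α → Prop} {a b : α}
    (h : ReflTransGen r a b) (ha : Q a) (hb : ¬ Q b) :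
    ∃ y z, ReflTransGen r a y ∧ r y z ∧ Q y ∧ ¬ Q z := by
  induction h with
  | refl => exact absurd ha hb
  | tail h1 h2 ih =>
    rename_i b c
    by_cases hq : Q b
    · exact ⟨b, c, h1, h2, hq, hb⟩
    · exact ih hq

theorem drain {α : Type*} {r H : α → α → Prop} {X : α → Prop} {a b t : α}
    (h : ReflTransGen r a b) (ha : X a) (hb : ¬ X b)
    (hX : ∀ x y, X x → r x y → H x y ∧ (X y ∨ y = t)) : ReflTransGen H a t := by
  induction h using ReflTransGen.head_induction_on with
  | refl => exact absurd ha hb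
  | head h1 h2 ih =>
    obtain ⟨h3, h4⟩ := hX _ _ ha h1
    rcases h4 with h4 | h4
    · exact ReflTransGen.head h3 (ih h4)
    · rw [← h4]; exact ReflTransGen.single h3

theorem exists_Fo (m : ℕ) : ∀ (s p : ℕ) (G : ℕ → ℕ → Prop), (∀ x y, G x y → G y x) →
    (p < s ∨ s + m ≤ p) → (∀ a b c d, G a b → G c d → ¬ (a < c ∧ c < b ∧ b < d)) →
    (∀ x y, G x y → x = p ∨ (s ≤ x ∧ x < s + m)) →
    (∀ x, s ≤ x → x < s + m → ReflTransGen G x p) →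
    ∃ F : Fo, sz F = m ∧ ∀ x y, Ed F s p x y → G x y := by
  induction m using Nat.strong_induction_on with
  | _ m ih =>
  intro s p G hsymm ho hnc hsupp hreach
  rcases Nat.eq_zero_or_pos m with rfl | hm
  · exact ⟨Fo.nil, rfl, fun x y h => h.elim⟩
  set G' : ℕ → ℕ → Prop := fun x y => G x y ∧ x ≠ p ∧ y ≠ p with hG'
  have hsymm' : ∀ x y, G' x y → G' y x := fun x y h => ⟨hsymm _ _ h.1, h.2.2, h.2.1⟩
  have rsymm : ∀ {x y}, ReflTransGen G' x y → ReflTransGen G' y x := fun {x y} h =>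
    by
      induction h with
      | refl => exact ReflTransGen.refl
      | tail _ h2 ih => exact ReflTransGen.head (hsymm' _ _ h2) ih
  -- the child `c` of `p` in whose component `s` lies
  obtain ⟨c, hcp, hsc⟩ : ∃ c, G c p ∧ ReflTransGen G' s c := by
    have key : ∀ x, ReflTransGen G x p → x ≠ p → ∃ c, G c p ∧ ReflTransGen G' x c := by
      intro x hx
      induction hx using ReflTransGen.head_induction_on with
      | refl => intro h; exact absurd rfl h
      | head h1 h2 ih =>
        rename_i a b
        intro ha
        by_cases hb : b = p
        · subst hb; exact ⟨a, h1, ReflTransGen.refl⟩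
        · obtain ⟨c, h3, h4⟩ := ih hb
          exact ⟨c, h3, ReflTransGen.head ⟨h1, ha, hb⟩ h4⟩
    exact key s (hreach s le_rfl (by omega)) (by omega)
  have hS : ∀ x, ReflTransGen G' s x → s ≤ x ∧ x < s + m := by
    intro x hx
    rcases ReflTransGen.cases_tail hx with h | ⟨b, _, h⟩
    · subst h; omega
    · rcases hsupp _ _ (hsymm _ _ h.1) with h1 | h1
      · exact absurd h1 h.2.2
      · exact h1
  have hex : ∃ e, s ≤ e ∧ ¬ ReflTransGen G' s e :=
    ⟨s + m, by omega, fun h => by have := hS _ h; omega⟩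
  classical
  obtain ⟨e, ⟨hse, hne⟩, hmin⟩ : ∃ e, (s ≤ e ∧ ¬ ReflTransGen G' s e) ∧
      ∀ x, s ≤ x → x < e → ReflTransGen G' s x := by
    refine ⟨Nat.find hex, Nat.find_spec hex, fun x hx hx' => ?_⟩
    have := Nat.find_min hex hx'
    by_contra h
    exact this ⟨hx, h⟩
  have het : e ≤ s + m := by
    by_contra h
    have := hS _ (hmin (s + m) (by omega) (by omega)); omega
  have hse' : s < e := by
    rcases hse.eq_or_lt with h | h
    · subst h; exact absurd ReflTransGen.refl hne
    · exact h
  have hSe : ∀ x, ReflTransGen G' s x → x < e := by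
    intro x hx
    by_contra hxe
    have hxe' : e ≠ x := by rintro rfl; exact hne hx
    have hxS := hS x hx
    obtain ⟨y, z, -, hyz, ⟨hy1, hy2, hy3⟩, hz⟩ := exit_lemma
      (Q := fun y => s < y ∧ y < x ∧ ¬ ReflTransGen G' s y)
      (hreach e hse (by omega)) ⟨hse', by omega, hne⟩ (by omega)
    have hz' : ¬ ReflTransGen G' s z ∧ (z < s ∨ x < z) := by
      by_cases hzp : z = p
      · subst hzp
        refine ⟨fun h => ?_, by omega⟩
        have := hS _ h; omega
      · have h1 : ¬ ReflTransGen G' s z := fun h =>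
          hy3 (h.tail ⟨hsymm _ _ hyz, hzp, by omega⟩)
        refine ⟨h1, ?_⟩
        have h2 : z ≠ s := by rintro rfl; exact h1 ReflTransGen.refl
        have h3 : z ≠ x := by rintro rfl; exact h1 hx
        by_contra h4
        exact hz ⟨by omega, by omega, h1⟩
    obtain ⟨hz1, hz2⟩ := hz'
    rcases hz2 with hz2 | hz2
    · -- `z < s < y < x`
      obtain ⟨v, w, hv, hvw, hv1, hw1⟩ := exit_lemma (Q := fun v => z < v ∧ v < y) hx
        ⟨hz2, hy1⟩ (by omega)
      have hw := hv.tail hvw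
      have h1 : w ≠ z := by rintro rfl; exact hz1 hw
      have h2 : w ≠ y := by rintro rfl; exact hy3 hw
      rcases lt_or_ge w z with h3 | h3
      · exact hnc w v z y (hsymm _ _ hvw.1) (hsymm _ _ hyz) (by omega)
      · exact hnc z y v w (hsymm _ _ hyz) hvw.1 (by omega)
    · obtain ⟨v, w, hv, hvw, hv1, hw1⟩ := exit_lemma (Q := fun v => ¬ (y < v ∧ v < z)) hx
        (by omega) (by omega)
      have hw := hv.tail hvw
      have h1 : v ≠ z := by rintro rfl; exact hz1 hv
      have h2 : v ≠ y := by rintro rfl; exact hy3 hv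
      rcases lt_or_ge v y with h3 | h3
      · exact hnc v w y z hvw.1 hyz (by omega)
      · exact hnc y z w v hyz (hsymm _ _ hvw.1) (by omega)
  have hc1 := hS c hsc
  have hc2 := hSe c hsc
  have hpc := hsymm _ _ hcp
  -- edges do not jump over `c`
  have hjump : ∀ x y, s ≤ x → y < e → G x y → ¬ (x < c ∧ c < y) := by
    intro x y hx hy hxy h
    rcases ho with ho | ho
    · exact hnc p c x y hpc hxy (by omega)
    · exact hnc x y c p hxy hcp (by omega)
  have hG'S : ∀ x y, s ≤ x → x < e → G' x y → s ≤ y ∧ y < e := by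
    intro x y hx hx' hxy
    have := (hmin x hx hx').tail hxy
    exact ⟨(hS _ this).1, hSe _ this⟩
  obtain ⟨L, hL1, hL2⟩ := ih (c - s) (by omega) s c
    (fun x y => G x y ∧ (s ≤ x ∧ x ≤ c) ∧ (s ≤ y ∧ y ≤ c))
    (fun x y h => ⟨hsymm _ _ h.1, h.2.2, h.2.1⟩) (by omega)
    (fun a b c d h h' => hnc a b c d h.1 h'.1) (fun x y h => by omega)
    (fun x hx hx' => by
      refine drain (r := G') (X := fun x => s ≤ x ∧ x < c) (b := c)
        ((rsymm (hmin x hx (by omega))).trans hsc) (by omega) (by omega) ?_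
      intro u v hu huv
      have h1 := hG'S u v hu.1 (by omega) huv
      have h2 := hjump u v hu.1 h1.2 huv.1
      exact ⟨⟨huv.1, by omega, by omega⟩, by omega⟩)
  obtain ⟨R, hR1, hR2⟩ := ih (e - (c + 1)) (by omega) (c + 1) c
    (fun x y => G x y ∧ (c ≤ x ∧ x < e) ∧ (c ≤ y ∧ y < e))
    (fun x y h => ⟨hsymm _ _ h.1, h.2.2, h.2.1⟩) (by omega)
    (fun a b c d h h' => hnc a b c d h.1 h'.1) (fun x y h => by omega)
    (fun x hx hx' => by
      refine drain (r := G') (X := fun x => c < x ∧ x < e) (b := c)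
        ((rsymm (hmin x (by omega) (by omega))).trans hsc) (by omega) (by omega) ?_
      intro u v hu huv
      have h1 := hG'S u v (by omega) (by omega) huv
      have h2 := hjump v u h1.1 hu.2 (hsymm _ _ huv.1)
      exact ⟨⟨huv.1, by omega, by omega⟩, by omega⟩)
  obtain ⟨T, hT1, hT2⟩ := ih (s + m - e) (by omega) e p
    (fun x y => G x y ∧ (x = p ∨ e ≤ x) ∧ (y = p ∨ e ≤ y))
    (fun x y h => ⟨hsymm _ _ h.1, h.2.2, h.2.1⟩) (by omega)
    (fun a b c d h h' => hnc a b c d h.1 h'.1)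
    (fun x y h => by have := hsupp x y h.1; omega)
    (fun x hx hx' => by
      refine drain (r := G) (X := fun x => e ≤ x ∧ x < s + m) (b := p)
        (hreach x (by omega) (by omega)) (by omega) (by omega) ?_
      intro u v hu huv
      have h1 := hsupp v u (hsymm _ _ huv)
      have h2 : v = p ∨ (e ≤ v ∧ v < s + m) := by
        rcases h1 with h1 | h1
        · exact Or.inl h1
        · by_contra h3
          have h4 := (hmin v h1.1 (by omega)).tail (c := u)
            ⟨hsymm _ _ huv, by omega, by omega⟩
          have := hSe u h4
          omega
      exact ⟨⟨huv, by omega, by omega⟩, by omega⟩)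
  refine ⟨Fo.cons L R T, by simp only [sz]; omega, ?_⟩
  intro x y h
  have e1 : s + sz L = c := by omega
  have e2 : c + 1 + sz R = e := by omega
  simp only [Ed, e1, e2] at h
  rcases h with ⟨rfl, rfl⟩ | h | h | h
  · exact hpc
  · exact (hL2 _ _ h).1
  · exact (hR2 _ _ h).1
  · exact (hT2 _ _ h).1

theorem Ad_p_min {L R T : Fo} {s p x : ℕ} (ho : p < s ∨ s + sz (Fo.cons L R T) ≤ p)
    (h : Ad (Fo.cons L R T) s p p x) : s + sz L ≤ x := by
  simp only [sz] at ho
  rcases Ad_cons.1 h with h | h | h | (h | h)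
  · omega
  · have := suppA h; omega
  · have := suppA h; omega
  · have := supp h; omega
  · have := supp h; omega

theorem e_le {L R T L' R' T' : Fo} {s p : ℕ} (ho : p < s ∨ s + sz (Fo.cons L R T) ≤ p)
    (hsz : sz (Fo.cons L R T) = sz (Fo.cons L' R' T')) (hL : sz L = sz L')
    (h : ∀ x y, Ad (Fo.cons L R T) s p x y → Ad (Fo.cons L' R' T') s p x y) :
    sz R' ≤ sz R := by
  by_contra hlt
  simp only [sz] at ho hsz
  obtain ⟨y, z, -, hyz, hy, hz⟩ := exit_lemma
    (Q := fun y => s + sz L + 1 + sz R ≤ y ∧ y < s + sz L + 1 + sz R')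
    (Ad_reach (F := T) (s := s + sz L + 1 + sz R) (p := p) le_rfl (by omega))
    (by omega) (by omega)
  have h1 := suppA hyz
  have h2 := h y z (Ad_cons.2 (by tauto))
  rcases Ad_cons.1 h2 with h2 | h2 | h2 | h2
  · omega
  · have := suppA h2; omega
  · have := suppA h2; omega
  · have := suppA h2; omega

theorem Fo_inj {F : Fo} : ∀ {F' : Fo} {s p : ℕ}, (p < s ∨ s + sz F ≤ p) → sz F = sz F' →
    (∀ x y, Ad F s p x y ↔ Ad F' s p x y) → F = F' := by
  induction F with
  | nil =>
    intro F' s p _ h _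
    cases F' with
    | nil => rfl
    | cons => simp [sz] at h
  | cons L R T hL hR hT =>
    intro F' s p ho hsz h
    cases F' with
    | nil => simp [sz] at hsz
    | cons L' R' T' =>
      have ho' : p < s ∨ s + sz (Fo.cons L' R' T') ≤ p := by omega
      have e1 : sz L = sz L' := by
        have h1 := Ad_p_min ho ((h p (s + sz L')).2 (Ad_cons.2 (by tauto)))
        have h2 := Ad_p_min ho' ((h p (s + sz L)).1 (Ad_cons.2 (by tauto)))
        omega
      have e2 : sz R = sz R' := le_antisymm
        (e_le ho' hsz.symm e1.symm (fun x y => (h x y).2)) (e_le ho hsz e1 (fun x y => (h x y).1))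
      have e3 : sz T = sz T' := by simp only [sz] at hsz; omega
      have ho2 := ho
      simp only [sz] at ho2
      have hl : L = L' := by
        refine hL (s := s) (p := s + sz L) (by omega) e1 fun x y => ?_
        rw [Ad_L ho, h]
        conv_rhs => rw [e1]
        rw [Ad_L ho', e1]
      have hr : R = R' := by
        refine hR (s := s + sz L + 1) (p := s + sz L) (by omega) e2 fun x y => ?_
        rw [Ad_R ho, h]
        conv_rhs => rw [e1]
        rw [Ad_R ho', e1, e2]
      have ht : T = T' := by
        refine hT (s := s + sz L + 1 + sz R) (p := p) (by omega) e3 fun x y => ?_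
        rw [Ad_T ho, h]
        conv_rhs => rw [e1, e2]
        rw [Ad_T ho', e1, e2]
      rw [hl, hr, ht]

theorem finN (F : Fo) (s p x : ℕ) : {y | Ad F s p x y}.Finite := by
  refine (Set.finite_Iio (p + s + sz F + 1)).subset fun y hy => ?_
  have := (suppA hy).2
  simp only [Set.mem_Iio]; omega

theorem deg_p {F : Fo} : ∀ {s p : ℕ}, (p < s ∨ s + sz F ≤ p) →
    {y | Ad F s p p y}.ncard = ln F := by
  induction F with
  | nil => intro s p _; simp [Ad, Ed, ln]
  | cons L R T hL hR hT =>
    intro s p ho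
    have : {y | Ad (Fo.cons L R T) s p p y} =
        insert (s + sz L) {y | Ad T (s + sz L + 1 + sz R) p p y} := by
      simp only [sz] at ho
      ext y
      simp only [Set.mem_ofPred_eq, Set.mem_insert_iff, Ad_cons]
      constructor
      · rintro (h | h | h | h)
        · omega
        · have := suppA h; omega
        · have := suppA h; omega
        · exact Or.inr h
      · tauto
    simp only [sz] at ho
    rw [this, Set.ncard_insert_of_notMem _ (finN _ _ _ _), hT (by omega), ln]
    intro h
    have := suppA h
    omega

theorem deg_all {A : Set ℕ} {F : Fo} : ∀ {s p : ℕ}, (p < s ∨ s + sz F ≤ p) →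
    (Dg A F ↔ ∀ x, s ≤ x → x < s + sz F → {y | Ad F s p x y}.ncard ∈ A) := by
  induction F with
  | nil => intro s p _; simp only [Dg, sz, true_iff]; intros; omega
  | cons L R T hL hR hT =>
    intro s p ho
    have ho' := ho
    simp only [sz] at ho
    have e1 : ∀ x, s ≤ x → x < s + sz L →
        {y | Ad (Fo.cons L R T) s p x y} = {y | Ad L s (s + sz L) x y} := by
      intro x hx hx'
      ext y
      simp only [Set.mem_ofPred_eq, Ad_cons]
      constructor
      · rintro (h | h | h | h)
        · omega
        · exact h
        · have := suppA h; omega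
        · have := suppA h; omega
      · tauto
    have e2 : ∀ x, s + sz L + 1 ≤ x → x < s + sz L + 1 + sz R →
        {y | Ad (Fo.cons L R T) s p x y} = {y | Ad R (s + sz L + 1) (s + sz L) x y} := by
      intro x hx hx'
      ext y
      simp only [Set.mem_ofPred_eq, Ad_cons]
      constructor
      · rintro (h | h | h | h)
        · omega
        · have := suppA h; omega
        · exact h
        · have := suppA h; omega
      · tauto
    have e3 : ∀ x, s + sz L + 1 + sz R ≤ x → x < s + sz L + 1 + sz R + sz T →
        {y | Ad (Fo.cons L R T) s p x y} = {y | Ad T (s + sz L + 1 + sz R) p x y} := by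
      intro x hx hx'
      ext y
      simp only [Set.mem_ofPred_eq, Ad_cons]
      constructor
      · rintro (h | h | h | h)
        · omega
        · have := suppA h; omega
        · have := suppA h; omega
        · exact h
      · tauto
    have e4 : {y | Ad (Fo.cons L R T) s p (s + sz L) y}.ncard = ln L + ln R + 1 := by
      have : {y | Ad (Fo.cons L R T) s p (s + sz L) y} =
          insert p ({y | Ad L s (s + sz L) (s + sz L) y} ∪
            {y | Ad R (s + sz L + 1) (s + sz L) (s + sz L) y}) := by
        ext y
        simp only [Set.mem_ofPred_eq, Set.mem_insert_iff, Set.mem_union, Ad_cons]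
        constructor
        · rintro (h | h | h | h)
          · omega
          · tauto
          · tauto
          · have := suppA h; omega
        · tauto
      rw [this, Set.ncard_insert_of_notMem _ ((finN _ _ _ _).union (finN _ _ _ _)),
        Set.ncard_union_eq _ (finN _ _ _ _) (finN _ _ _ _), deg_p (by omega), deg_p (by omega)]
      · rw [Set.disjoint_left]
        rintro y (hy | hy) (hy' | hy') <;> have := supp hy <;> have := supp hy' <;> omega
      · rintro (h | h) <;> have := suppA h <;> omega
    rw [Dg, hL (s := s) (p := s + sz L) (by omega),
      hR (s := s + sz L + 1) (p := s + sz L) (by omega),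
      hT (s := s + sz L + 1 + sz R) (p := p) (by omega)]
    constructor
    · rintro ⟨h1, h2, h3, h4⟩ x hx hx'
      simp only [sz] at hx'
      rcases lt_trichotomy x (s + sz L) with h | h | h
      · rw [e1 x hx h]; exact h2 x hx h
      · rw [h, e4]; exact h1
      · by_cases h' : x < s + sz L + 1 + sz R
        · rw [e2 x h h']; exact h3 x h h'
        · rw [e3 x (by omega) (by omega)]; exact h4 x (by omega) (by omega)
    · intro h
      simp only [sz] at h
      refine ⟨?_, fun x hx hx' => ?_, fun x hx hx' => ?_, fun x hx hx' => ?_⟩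
      · rw [← e4]; exact h _ (by omega) (by omega)
      · rw [← e1 x hx hx']; exact h _ (by omega) (by omega)
      · rw [← e2 x hx hx']; exact h _ (by omega) (by omega)
      · rw [← e3 x hx hx']; exact h _ (by omega) (by omega)

end NCProof

namespace NCProof

/-- Orientation determinant. -/
noncomputable def ori (p q z : ℂ) : ℝ := (q.re - p.re) * (z.im - p.im) - (q.im - p.im) * (z.re - p.re)

theorem ncPos_re (n k : ℕ) : (ncPos n k).re = Real.cos (2 * (Real.pi * k / n)) := by
  have : (-(2 * Real.pi * Complex.I) * k / n : ℂ) = ((-(2 * (Real.pi * k / n)) : ℝ) : ℂ) * Complex.I := by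
    push_cast; ring
  rw [ncPos, this, Complex.exp_ofReal_mul_I_re, Real.cos_neg]

theorem ncPos_im (n k : ℕ) : (ncPos n k).im = - Real.sin (2 * (Real.pi * k / n)) := by
  have : (-(2 * Real.pi * Complex.I) * k / n : ℂ) = ((-(2 * (Real.pi * k / n)) : ℝ) : ℂ) * Complex.I := by
    push_cast; ring
  rw [ncPos, this, Complex.exp_ofReal_mul_I_im, Real.sin_neg]

theorem trig_id (a b c : ℝ) :
    (Real.cos (2 * b) - Real.cos (2 * a)) * (- Real.sin (2 * c) - - Real.sin (2 * a)) -
      (- Real.sin (2 * b) - - Real.sin (2 * a)) * (Real.cos (2 * c) - Real.cos (2 * a)) =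
    - (4 * Real.sin (b - a) * Real.sin (c - b) * Real.sin (c - a)) := by
  have h1 : c - a = (b - a) + (c - b) := by ring
  have e1 : Real.sin (2 * (b - a)) = Real.sin (2 * b) * Real.cos (2 * a) -
      Real.cos (2 * b) * Real.sin (2 * a) := by rw [mul_sub, Real.sin_sub]
  have e2 : Real.sin (2 * (c - b)) = Real.sin (2 * c) * Real.cos (2 * b) -
      Real.cos (2 * c) * Real.sin (2 * b) := by rw [mul_sub, Real.sin_sub]
  have e3 : Real.sin (2 * (b - a) + 2 * (c - b)) = Real.sin (2 * c) * Real.cos (2 * a) -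
      Real.cos (2 * c) * Real.sin (2 * a) := by rw [← Real.sin_sub]; ring_nf
  rw [h1]
  generalize b - a = x at *
  generalize c - b = y at *
  have e4 : Real.sin (2 * x) + Real.sin (2 * y) - Real.sin (2 * x + 2 * y) =
      4 * Real.sin x * Real.sin y * Real.sin (x + y) := by
    rw [Real.sin_add, Real.sin_add, Real.cos_two_mul, Real.cos_two_mul, Real.sin_two_mul,
      Real.sin_two_mul]
    have hx := Real.sin_sq_add_cos_sq x
    have hy := Real.sin_sq_add_cos_sq y
    have hx' : Real.cos x ^ 2 = 1 - Real.sin x ^ 2 := by linarith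
    have hy' : Real.cos y ^ 2 = 1 - Real.sin y ^ 2 := by linarith
    rw [hx', hy']
    ring
  rw [← e4, e1, e2, e3]
  ring

theorem ori_pos {n i j k : ℕ} (hij : i < j) (hjk : j < k) (hk : k < n) :
    ori (ncPos n i) (ncPos n j) (ncPos n k) < 0 := by
  have hn : (0 : ℝ) < n := by exact_mod_cast (by omega : 0 < n)
  have key : ∀ a b : ℕ, a < b → b < n → 0 < Real.sin (Real.pi * b / n - Real.pi * a / n) := by
    intro a b hab hb
    have h1 : (a : ℝ) < b := by exact_mod_cast hab
    have h2 : (b : ℝ) < n := by exact_mod_cast hb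
    have h3 : (0 : ℝ) ≤ a := by positivity
    have : Real.pi * b / n - Real.pi * a / n = Real.pi * ((b - a) / n) := by ring
    rw [this]
    apply Real.sin_pos_of_pos_of_lt_pi
    · have : 0 < ((b : ℝ) - a) / n := div_pos (by linarith) hn
      have := Real.pi_pos
      positivity
    · have : ((b : ℝ) - a) / n < 1 := by rw [div_lt_one hn]; linarith
      have := Real.pi_pos
      nlinarith
  rw [ori, ncPos_re, ncPos_re, ncPos_re, ncPos_im, ncPos_im, ncPos_im, trig_id]
  have h1 := key i j hij (by omega)
  have h2 := key j k hjk hk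
  have h3 := key i k (by omega) hk
  have : 0 < 4 * Real.sin (Real.pi * j / n - Real.pi * i / n) *
    Real.sin (Real.pi * k / n - Real.pi * j / n) * Real.sin (Real.pi * k / n - Real.pi * i / n) := by
    positivity
  linarith

theorem ori_rot (p q z : ℂ) : ori p q z = ori z p q := by unfold ori; ring
theorem ori_swap (p q z : ℂ) : ori p q z = - ori q p z := by unfold ori; ring

theorem ncPos_ne {n i j : ℕ} (hij : i < j) (hj : j < n) : ncPos n i ≠ ncPos n j := by
  intro h
  have h1 := congrArg Complex.re h
  have h2 := congrArg Complex.im h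
  rw [ncPos_re, ncPos_re] at h1
  rw [ncPos_im, ncPos_im] at h2
  have hn : (0 : ℝ) < n := by exact_mod_cast (by omega : 0 < n)
  have h3 : (i : ℝ) < j := by exact_mod_cast hij
  have h4 : (j : ℝ) < n := by exact_mod_cast hj
  have h5 : (0 : ℝ) ≤ i := by positivity
  have hsin : 0 < Real.sin (Real.pi * j / n - Real.pi * i / n) := by
    have : Real.pi * j / n - Real.pi * i / n = Real.pi * ((j - i) / n) := by ring
    rw [this]
    apply Real.sin_pos_of_pos_of_lt_pi
    · have : 0 < ((j : ℝ) - i) / n := div_pos (by linarith) hn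
      have := Real.pi_pos
      positivity
    · have : ((j : ℝ) - i) / n < 1 := by rw [div_lt_one hn]; linarith
      have := Real.pi_pos
      nlinarith
  have h6 : Real.cos (2 * (Real.pi * j / n - Real.pi * i / n)) = 1 := by
    rw [mul_sub, Real.cos_sub, h1, neg_inj.1 h2]
    have := Real.sin_sq_add_cos_sq (2 * (Real.pi * j / n))
    linarith
  rw [Real.cos_two_mul] at h6
  have := Real.sin_sq_add_cos_sq (Real.pi * j / n - Real.pi * i / n)
  nlinarith

/-- sign of the orientation, first two indices increasing -/
theorem ori_in {n i j k : ℕ} (h1 : i < k) (h2 : k < j) (hj : j < n) :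
    0 < ori (ncPos n i) (ncPos n j) (ncPos n k) := by
  have := ori_pos h1 h2 hj
  rw [ori_rot, ori_swap] at this
  rw [ori_swap, ori_rot, ori_swap, neg_neg, ori_rot, ori_rot]
  first
  | linarith
  | (unfold ori at *; linarith)

theorem ori_out {n i j k : ℕ} (hij : i < j) (hj : j < n) (hk : k < n) (h : k < i ∨ j < k) :
    ori (ncPos n i) (ncPos n j) (ncPos n k) < 0 := by
  rcases h with h | h
  · have := ori_pos h hij hj
    rw [ori_rot]; exact this
  · exact ori_pos hij h hk

theorem ori_seg {p q a b z : ℂ} (s t : ℝ) (hst : s + t = 1) (hz : s • a + t • b = z) :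
    ori p q z = s * ori p q a + t * ori p q b := by
  have hs : s = 1 - t := by linarith
  subst hs
  rw [← hz]
  simp only [ori, Complex.add_re, Complex.add_im, Complex.real_smul, Complex.re_ofReal_mul,
    Complex.im_ofReal_mul]
  ring

theorem ori_left (p q : ℂ) : ori p q p = 0 := by unfold ori; ring
theorem ori_right (p q : ℂ) : ori p q q = 0 := by unfold ori; ring

/-- Combinatorially noncrossing edges are geometrically noncrossing; `a < b` version. -/
theorem geom_nc {n a b c d : ℕ} (hab : a < b) (hb : b < n) (hc : c < n) (hd : d < n)
    (hcd : c ≠ d) (hne : ¬ (c = a ∧ d = b) ∧ ¬ (c = b ∧ d = a))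
    (h : ((a ≤ c ∧ c ≤ b) ∧ (a ≤ d ∧ d ≤ b)) ∨ ((c ≤ a ∨ b ≤ c) ∧ (d ≤ a ∨ b ≤ d))) {z : ℂ}
    (hz1 : z ∈ segment ℝ (ncPos n a) (ncPos n b)) (hz2 : z ∈ segment ℝ (ncPos n c) (ncPos n d)) :
    (z = ncPos n a ∨ z = ncPos n b) ∧ (z = ncPos n c ∨ z = ncPos n d) := by
  obtain ⟨u, v, hu, hv, huv, hz'⟩ := hz1
  obtain ⟨s, t, hs, ht, hst, hz⟩ := hz2
  have hab0 := ori_seg (p := ncPos n a) (q := ncPos n b) u v huv hz'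
  have hcd0 := ori_seg (p := ncPos n a) (q := ncPos n b) s t hst hz
  rw [ori_left, ori_right] at hab0
  rw [hab0] at hcd0
  by_cases hca : c = a ∨ c = b
  · have hd' : d ≠ a ∧ d ≠ b := by omega
    have hc0 : ori (ncPos n a) (ncPos n b) (ncPos n c) = 0 := by
      rcases hca with rfl | rfl
      · exact ori_left _ _
      · exact ori_right _ _
    have hd0 : ori (ncPos n a) (ncPos n b) (ncPos n d) ≠ 0 := by
      by_cases hd2 : a < d ∧ d < b
      · exact (ori_in hd2.1 hd2.2 hb).ne'
      · exact (ori_out hab hb hd (by omega)).ne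
    rw [hc0] at hcd0
    have ht0 : t = 0 := by
      have : t * ori (ncPos n a) (ncPos n b) (ncPos n d) = 0 := by linarith
      exact (mul_eq_zero.1 this).resolve_right hd0
    have hs1 : s = 1 := by linarith
    subst ht0 hs1
    have hzc : z = ncPos n c := by rw [← hz]; simp
    refine ⟨?_, Or.inl hzc⟩
    rcases hca with h | h
    · left; rw [hzc, h]
    · right; rw [hzc, h]
  · by_cases hda : d = a ∨ d = b
    · have hd0 : ori (ncPos n a) (ncPos n b) (ncPos n d) = 0 := by
        rcases hda with rfl | rfl
        · exact ori_left _ _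
        · exact ori_right _ _
      have hc0 : ori (ncPos n a) (ncPos n b) (ncPos n c) ≠ 0 := by
        by_cases hd2 : a < c ∧ c < b
        · exact (ori_in hd2.1 hd2.2 hb).ne'
        · exact (ori_out hab hb hc (by omega)).ne
      rw [hd0] at hcd0
      have ht0 : s = 0 := by
        have : s * ori (ncPos n a) (ncPos n b) (ncPos n c) = 0 := by linarith
        exact (mul_eq_zero.1 this).resolve_right hc0
      have hs1 : t = 1 := by linarith
      subst ht0 hs1
      have hzc : z = ncPos n d := by rw [← hz]; simp
      refine ⟨?_, Or.inr hzc⟩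
      rcases hda with h | h
      · left; rw [hzc, h]
      · right; rw [hzc, h]
    · exfalso
      have hs0 : 0 < s ∨ 0 < t := by
        by_contra hcon
        push Not at hcon
        linarith
      by_cases h2 : a < c ∧ c < b
      · have h3 := ori_in h2.1 h2.2 hb
        have h4 : 0 < ori (ncPos n a) (ncPos n b) (ncPos n d) :=
          ori_in (by omega) (by omega) hb
        rcases hs0 with hs0 | hs0
        · have := mul_pos hs0 h3
          have := mul_nonneg ht h4.le
          linarith
        · have := mul_nonneg hs h3.le
          have := mul_pos hs0 h4
          linarith
      · have h3 := ori_out hab hb hc (by omega)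
        have h4 := ori_out hab hb hd (by omega)
        rcases hs0 with hs0 | hs0
        · have := mul_neg_of_pos_of_neg hs0 h3
          have := mul_nonpos_of_nonneg_of_nonpos ht h4.le
          linarith
        · have := mul_nonpos_of_nonneg_of_nonpos hs h3.le
          have := mul_neg_of_pos_of_neg hs0 h4
          linarith

/-- Crossing indices give a geometric crossing. -/
theorem geom_cross {n a b c d : ℕ} (hac : a < c) (hcb : c < b) (hbd : b < d) (hd : d < n) :
    ∃ z, z ∈ segment ℝ (ncPos n a) (ncPos n b) ∧ z ∈ segment ℝ (ncPos n c) (ncPos n d) ∧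
      z ≠ ncPos n a ∧ z ≠ ncPos n b := by
  -- cyclic order a, c, b, d
  have h1 := ori_pos hcb hbd hd
  have h2 := ori_pos (hac.trans hcb) hbd hd
  have h3 := ori_pos hac (hcb.trans hbd) hd
  have h4 := ori_pos hac hcb (hbd.trans hd)
  have hab := ncPos_ne (hac.trans hcb) (hbd.trans hd)
  generalize ncPos n a = A at *
  generalize ncPos n b = B at *
  generalize ncPos n c = C at *
  generalize ncPos n d = D at *
  have hsum : ori C B D + ori A C D = ori A B D + ori A C B := by unfold ori; ring
  have hS : ori C B D + ori A C D < 0 := by linarith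
  have hre : ori C B D * A.re + ori A C D * B.re = ori A B D * C.re + ori A C B * D.re := by
    unfold ori; ring
  have him : ori C B D * A.im + ori A C D * B.im = ori A B D * C.im + ori A C B * D.im := by
    unfold ori; ring
  set S := ori C B D + ori A C D with hSdef
  set z : ℂ := (ori C B D / S) • A + (ori A C D / S) • B with hz
  have e1 : ori C B D / S + ori A C D / S = 1 := by rw [← add_div]; exact div_self hS.ne
  have e2 : ori A B D / S + ori A C B / S = 1 := by
    rw [← add_div, ← hsum]; exact div_self hS.ne
  have p1 : 0 < ori C B D / S := div_pos_of_neg_of_neg h1 hS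
  have p2 : 0 < ori A C D / S := div_pos_of_neg_of_neg h3 hS
  have p3 : 0 < ori A B D / S := div_pos_of_neg_of_neg h2 hS
  have p4 : 0 < ori A C B / S := div_pos_of_neg_of_neg h4 hS
  refine ⟨z, ⟨_, _, p1.le, p2.le, e1, rfl⟩, ⟨_, _, p3.le, p4.le, e2, ?_⟩, ?_, ?_⟩
  · rw [hz]
    apply Complex.ext
    · simp only [Complex.add_re, Complex.real_smul, Complex.re_ofReal_mul]
      rw [div_mul_eq_mul_div, div_mul_eq_mul_div, div_mul_eq_mul_div, div_mul_eq_mul_div,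
        ← add_div, ← add_div, hre]
    · simp only [Complex.add_im, Complex.real_smul, Complex.im_ofReal_mul]
      rw [div_mul_eq_mul_div, div_mul_eq_mul_div, div_mul_eq_mul_div, div_mul_eq_mul_div,
        ← add_div, ← add_div, him]
  · intro h
    have e3 : ori C B D / S = 1 - ori A C D / S := by linarith
    rw [hz, e3] at h
    have : (ori A C D / S) • (B - A) = 0 := by
      rw [smul_sub, sub_eq_zero]
      rw [sub_smul, one_smul] at h
      linear_combination h
    rcases smul_eq_zero.1 this with h' | h'
    · exact p2.ne' h'
    · exact hab (sub_eq_zero.1 h').symm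
  · intro h
    have e3 : ori A C D / S = 1 - ori C B D / S := by linarith
    rw [hz, e3] at h
    have : (ori C B D / S) • (A - B) = 0 := by
      rw [smul_sub, sub_eq_zero]
      rw [sub_smul, one_smul] at h
      linear_combination h
    rcases smul_eq_zero.1 this with h' | h'
    · exact p1.ne' h'
    · exact hab (sub_eq_zero.1 h')

end NCProof

namespace NCProof

/-- Plane forests, encoded as binary trees: children of the first root, rest of the forest. -/
inductive Pf where
  | nil : Pf
  | cons : Pf → Pf → Pf

def psz : Pf → ℕ
  | Pf.nil => 0
  | Pf.cons C R => psz C + psz R + 1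

def pln : Pf → ℕ
  | Pf.nil => 0
  | Pf.cons _ R => pln R + 1

def pw : Pf → ℕ
  | Pf.nil => 1
  | Pf.cons C R => (pln C + 1) * pw C * pw R

def PD (A : Set ℕ) : Pf → Prop
  | Pf.nil => True
  | Pf.cons C R => pln C + 1 ∈ A ∧ PD A C ∧ PD A R

def app : Pf → Pf → Pf
  | Pf.nil, Q => Q
  | Pf.cons C R, Q => Pf.cons C (app R Q)

def fl : Fo → Pf
  | Fo.nil => Pf.nil
  | Fo.cons L R T => Pf.cons (app (fl L) (fl R)) (fl T)

theorem psz_app (P Q : Pf) : psz (app P Q) = psz P + psz Q := by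
  induction P with
  | nil => simp [app, psz]
  | cons C R _ ih => simp only [app, psz, ih]; omega

theorem pln_app (P Q : Pf) : pln (app P Q) = pln P + pln Q := by
  induction P with
  | nil => simp [app, pln]
  | cons C R _ ih => simp only [app, pln, ih]; omega

theorem PD_app (A : Set ℕ) (P Q : Pf) : PD A (app P Q) ↔ PD A P ∧ PD A Q := by
  induction P with
  | nil => simp [app, PD]
  | cons C R _ ih => simp only [app, PD, ih]; tauto

theorem psz_fl (F : Fo) : psz (fl F) = sz F := by
  induction F with
  | nil => rfl
  | cons L R T h1 h2 h3 => simp only [fl, psz, sz, psz_app, h1, h2, h3]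

theorem pln_fl (F : Fo) : pln (fl F) = ln F := by
  induction F with
  | nil => rfl
  | cons L R T h1 h2 h3 => simp only [fl, pln, ln, h3]

theorem PD_fl (A : Set ℕ) (F : Fo) : PD A (fl F) ↔ Dg A F := by
  induction F with
  | nil => rfl
  | cons L R T h1 h2 h3 =>
    simp only [fl, PD, Dg, PD_app, h1, h2, h3, pln_app, pln_fl]; tauto

theorem pw_pos (P : Pf) : 0 < pw P := by
  induction P with
  | nil => simp [pw]
  | cons C R h1 h2 => simp only [pw]; positivity

noncomputable def eqv1 (X Y : Pf) :
    ({q : Fo × Fo // app (fl q.1) (fl q.2) = X} × {T : Fo // fl T = Y}) ≃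
      {F : Fo // fl F = Pf.cons X Y} :=
  Equiv.ofBijective (fun q => ⟨Fo.cons q.1.1.1 q.1.1.2 q.2.1, by
    rw [fl, q.1.2, q.2.2]⟩) (by
    constructor
    · rintro ⟨⟨⟨a, b⟩, h⟩, ⟨c, h'⟩⟩ ⟨⟨⟨a', b'⟩, h2⟩, ⟨c', h2'⟩⟩ he
      simp only [Subtype.mk.injEq, Fo.cons.injEq] at he
      obtain ⟨rfl, rfl, rfl⟩ := he
      rfl
    · rintro ⟨F, h⟩
      cases F with
      | nil => simp [fl] at h
      | cons a b c =>
        simp only [fl, Pf.cons.injEq] at h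
        exact ⟨⟨⟨⟨a, b⟩, h.1⟩, ⟨c, h.2⟩⟩, rfl⟩)

noncomputable def eqv2 (X Y : Pf) :
    ({F : Fo // fl F = Pf.cons X Y} ⊕ ({q : Fo × Fo // app (fl q.1) (fl q.2) = X} ×
      {q : Fo × Fo // app (fl q.1) (fl q.2) = Y})) ≃
      {q : Fo × Fo // app (fl q.1) (fl q.2) = Pf.cons X Y} :=
  Equiv.ofBijective (Sum.elim (fun F => ⟨(Fo.nil, F.1), by simp only [fl, app, F.2]⟩)
    (fun q => ⟨(Fo.cons q.1.1.1 q.1.1.2 q.2.1.1, q.2.1.2), by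
      simp only [fl, app, q.1.2, q.2.2]⟩)) (by
    constructor
    · rintro (⟨F, h⟩ | ⟨⟨⟨a, b⟩, h⟩, ⟨⟨c, d⟩, h'⟩⟩) (⟨F', h2⟩ | ⟨⟨⟨a', b'⟩, h2⟩, ⟨⟨c', d'⟩, h2'⟩⟩) he
      · simp at he; subst he; rfl
      · simp at he
      · simp at he
      · simp at he
        obtain ⟨⟨rfl, rfl, rfl⟩, rfl⟩ := he
        rfl
    · rintro ⟨⟨F, F'⟩, h⟩
      cases F with
      | nil => exact ⟨Sum.inl ⟨F', h⟩, rfl⟩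
      | cons a b c =>
        simp only [fl, app, Pf.cons.injEq] at h
        exact ⟨Sum.inr ⟨⟨⟨a, b⟩, h.1⟩, ⟨⟨c, F'⟩, h.2⟩⟩, rfl⟩)

theorem fiber_card (P : Pf) : Nat.card {F : Fo // fl F = P} = pw P ∧
    Nat.card {q : Fo × Fo // app (fl q.1) (fl q.2) = P} = (pln P + 1) * pw P := by
  induction P with
  | nil =>
    have h1 : ∀ F, fl F = Pf.nil ↔ F = Fo.nil := by
      intro F; cases F <;> simp [fl]
    have h2 : ∀ q : Fo × Fo, app (fl q.1) (fl q.2) = Pf.nil ↔ q = (Fo.nil, Fo.nil) := by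
      rintro ⟨F, F'⟩
      cases F <;> simp [fl, app, h1]
    simp only [h1, h2]
    simp [pw, pln]
  | cons X Y hX hY =>
    have e1 : Nat.card {F : Fo // fl F = Pf.cons X Y} = pw (Pf.cons X Y) := by
      rw [← Nat.card_congr (eqv1 X Y), Nat.card_prod, hX.2, hY.1, pw]
    have f1 : Finite {F : Fo // fl F = Pf.cons X Y} :=
      Nat.finite_of_card_ne_zero (by rw [e1]; exact (pw_pos _).ne')
    have f2 : Finite {q : Fo × Fo // app (fl q.1) (fl q.2) = X} :=
      Nat.finite_of_card_ne_zero (by rw [hX.2]; have := pw_pos X; positivity)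
    have f3 : Finite {q : Fo × Fo // app (fl q.1) (fl q.2) = Y} :=
      Nat.finite_of_card_ne_zero (by rw [hY.2]; have := pw_pos Y; positivity)
    refine ⟨e1, ?_⟩
    rw [← Nat.card_congr (eqv2 X Y), Nat.card_sum, Nat.card_prod, hX.2, hY.2, e1]
    simp only [pw, pln]
    ring

theorem Pf_finite (m : ℕ) : {P : Pf | psz P ≤ m}.Finite := by
  induction m with
  | zero =>
    refine (Set.finite_singleton Pf.nil).subset ?_
    intro P hP
    cases P with
    | nil => rfl
    | cons => simp [psz] at hP
  | succ m ih =>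
    refine ((Set.finite_singleton Pf.nil).union (ih.image2 Pf.cons ih)).subset ?_
    intro P hP
    cases P with
    | nil => exact Or.inl rfl
    | cons C R =>
      simp only [Set.mem_ofPred_eq, psz] at hP
      refine Or.inr ⟨C, ?_, R, ?_, rfl⟩ <;> simp only [Set.mem_ofPred_eq] <;> omega

theorem count_Fo (A : Set ℕ) (m : ℕ) :
    Nat.card {F : Fo // sz F = m ∧ ln F ∈ A ∧ Dg A F} =
      ∑ᶠ P ∈ {P : Pf | psz P = m ∧ pln P ∈ A ∧ PD A P}, pw P := by
  set SP : Set Pf := {P : Pf | psz P = m ∧ pln P ∈ A ∧ PD A P} with hSP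
  have hfin : SP.Finite := (Pf_finite m).subset fun P hP => hP.1.le
  have : Finite SP := hfin
  have := Fintype.ofFinite SP
  have hmem : ∀ F, (sz F = m ∧ ln F ∈ A ∧ Dg A F) ↔ fl F ∈ SP := by
    intro F
    simp only [hSP, Set.mem_ofPred_eq, psz_fl, pln_fl, PD_fl]
  have hf : ∀ P : SP, Finite {F : Fo // fl F = P.1} := fun P =>
    Nat.finite_of_card_ne_zero (by rw [(fiber_card _).1]; exact (pw_pos _).ne')
  have e : (Σ P : SP, {F : Fo // fl F = P.1}) ≃ {F : Fo // sz F = m ∧ ln F ∈ A ∧ Dg A F} :=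
    { toFun := fun q => ⟨q.2.1, by rw [hmem, q.2.2]; exact q.1.2⟩
      invFun := fun F => ⟨⟨fl F.1, (hmem _).1 F.2⟩, ⟨F.1, rfl⟩⟩
      left_inv := by 
        rintro ⟨⟨P, hP⟩, ⟨F, h⟩⟩
        have h' : fl F = P := h
        subst h'
        rfl
      right_inv := by rintro ⟨F, h⟩; rfl }
  rw [← Nat.card_congr e, Nat.card_sigma, ← finsum_set_coe_eq_finsum_mem,
    finsum_eq_sum_of_fintype]
  exact Finset.sum_congr rfl fun P _ => (fiber_card _).1

/-! ### Plane trees -/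

/-- The vertices of a plane forest whose roots are labelled `i, i+1, …`. -/
def V : Pf → ℕ → Finset (List ℕ)
  | Pf.nil, _ => ∅
  | Pf.cons C R, i => (insert [] (V C 1)).image (List.cons i) ∪ V R (i + 1)

theorem nil_notMem (P : Pf) : ∀ i, [] ∉ V P i := by
  induction P with
  | nil => intro i; simp [V]
  | cons C R _ ih => intro i; simp [V, ih]

theorem mem_V_cons {C R : Pf} {i j : ℕ} {u : List ℕ} : j :: u ∈ V (Pf.cons C R) i ↔
    (j = i ∧ (u = [] ∨ u ∈ V C 1)) ∨ j :: u ∈ V R (i + 1) := by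
  simp only [V, Finset.mem_union, Finset.mem_image, Finset.mem_insert, List.cons.injEq]
  constructor
  · rintro (⟨a, h, rfl, rfl⟩ | h)
    · exact Or.inl ⟨rfl, h⟩
    · exact Or.inr h
  · rintro (⟨rfl, h⟩ | h)
    · exact Or.inl ⟨u, h, rfl, rfl⟩
    · exact Or.inr h

theorem head_le {P : Pf} : ∀ {i j : ℕ} {u : List ℕ}, j :: u ∈ V P i → i ≤ j := by
  induction P with
  | nil => intro i j u h; simp [V] at h
  | cons C R _ ih =>
    intro i j u h
    rcases mem_V_cons.1 h with h | h
    · omega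
    · have := ih h; omega

theorem mem_V_eq {C R : Pf} {i : ℕ} {u : List ℕ} : i :: u ∈ V (Pf.cons C R) i ↔
    (u = [] ∨ u ∈ V C 1) := by
  rw [mem_V_cons]
  constructor
  · rintro (h | h)
    · exact h.2
    · have := head_le h; omega
  · exact fun h => Or.inl ⟨rfl, h⟩

theorem mem_V_lt {C R : Pf} {i j : ℕ} (hij : i < j) {u : List ℕ} :
    j :: u ∈ V (Pf.cons C R) i ↔ j :: u ∈ V R (i + 1) := by
  rw [mem_V_cons]
  constructor
  · rintro (h | h)
    · omega
    · exact h
  · exact Or.inr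

theorem V_inj {P : Pf} : ∀ {P' : Pf} {i : ℕ}, V P i = V P' i → P = P' := by
  induction P with
  | nil =>
    intro P' i h
    cases P' with
    | nil => rfl
    | cons C R =>
      have : [i] ∈ V (Pf.cons C R) i := mem_V_eq.2 (Or.inl rfl)
      rw [← h] at this
      simp [V] at this
  | cons C R hC hR =>
    intro P' i h
    cases P' with
    | nil =>
      have : [i] ∈ V (Pf.cons C R) i := mem_V_eq.2 (Or.inl rfl)
      rw [h] at this
      simp [V] at this
    | cons C' R' =>
      have h1 : C = C' := by
        apply hC (i := 1)
        ext u
        by_cases hu : u = []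
        · subst hu; simp [nil_notMem]
        · have h1 : i :: u ∈ V (Pf.cons C R) i ↔ i :: u ∈ V (Pf.cons C' R') i := by rw [h]
          rw [mem_V_eq, mem_V_eq] at h1
          simpa [hu] using h1
      have h2 : R = R' := by
        apply hR (i := i + 1)
        ext u
        cases u with
        | nil => simp [nil_notMem]
        | cons j u =>
          by_cases hj : i < j
          · rw [← mem_V_lt (C := C) hj, ← mem_V_lt (C := C') hj, h]
          · constructor <;> intro h <;> have := head_le h <;> omega
      rw [h1, h2]

structure IsForest (W : Finset (List ℕ)) (i : ℕ) : Prop where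
  nil : [] ∉ W
  pre : ∀ u v : List ℕ, u ≠ [] → u <+: v → v ∈ W → u ∈ W
  lab : ∀ u ∈ W, ∀ j ∈ u, 1 ≤ j
  head : ∀ j u, j :: u ∈ W → i ≤ j
  ch : ∀ (u : List ℕ) (j : ℕ), u ≠ [] → 1 ≤ j → u ++ [j + 1] ∈ W → u ++ [j] ∈ W
  ch0 : ∀ j, i ≤ j → [j + 1] ∈ W → [j] ∈ W

theorem V_forest {P : Pf} : ∀ {i : ℕ}, 1 ≤ i → IsForest (V P i) i := by
  induction P with
  | nil => intro i _; constructor <;> simp [V]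
  | cons C R hC hR =>
    intro i hi
    have HC := hC (i := 1) le_rfl
    have HR := hR (i := i + 1) (by omega)
    refine ⟨nil_notMem _ _, ?_, ?_, fun _ _ => head_le, ?_, ?_⟩
    · intro u v hu huv hv
      cases u with
      | nil => exact absurd rfl hu
      | cons a u =>
        cases v with
        | nil => simp at huv
        | cons b v =>
          rw [List.cons_prefix_cons] at huv
          obtain ⟨rfl, huv⟩ := huv
          rw [mem_V_cons] at hv ⊢
          rcases hv with ⟨h, hv⟩ | hv
          · refine Or.inl ⟨h, ?_⟩
            by_cases hu : u = []
            · exact Or.inl hu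
            · rcases hv with rfl | hv
              · simp at huv; exact absurd huv hu
              · exact Or.inr (HC.pre u v hu huv hv)
          · exact Or.inr (HR.pre _ (a :: v) hu (by rw [List.cons_prefix_cons]; exact ⟨rfl, huv⟩) hv)
    · intro u hu j hj
      cases u with
      | nil => simp at hj
      | cons a u =>
        rcases mem_V_cons.1 hu with ⟨h, hv⟩ | hv
        · rcases List.mem_cons.1 hj with rfl | hj
          · omega
          · rcases hv with rfl | hv
            · simp at hj
            · exact HC.lab u hv j hj
        · exact HR.lab _ hv j hj
    · intro u j hu hj h
      cases u with
      | nil => exact absurd rfl hu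
      | cons a u =>
        rw [List.cons_append, mem_V_cons] at h ⊢
        rcases h with ⟨h1, h⟩ | h
        · refine Or.inl ⟨h1, ?_⟩
          rcases h with h | h
          · simp at h
          · right
            by_cases hu : u = []
            · subst hu; exact HC.ch0 j hj h
            · exact HC.ch u j hu hj h
        · exact Or.inr (HR.ch (a :: u) j hu hj h)
    · intro j hj h
      rcases hj.eq_or_lt with rfl | hj
      · exact mem_V_eq.2 (Or.inl rfl)
      · rw [mem_V_lt (by omega)] at h ⊢
        exact HR.ch0 j hj h

theorem V_surj (N : ℕ) : ∀ (W : Finset (List ℕ)) (i : ℕ), W.card ≤ N → 1 ≤ i → IsForest W i →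
    ∃ P, V P i = W := by
  induction N with
  | zero =>
    intro W i hW _ _
    exact ⟨Pf.nil, by rw [V]; exact (Finset.card_eq_zero.1 (by omega)).symm⟩
  | succ N ih =>
    intro W i hW hi HW
    rcases W.eq_empty_or_nonempty with rfl | ⟨w, hw⟩
    · exact ⟨Pf.nil, rfl⟩
    have hiW : [i] ∈ W := by
      cases w with
      | nil => exact absurd hw HW.nil
      | cons j u =>
        have hj := HW.head _ _ hw
        have hj1 : [j] ∈ W := HW.pre [j] (j :: u) (by simp) (by simp) hw
        have key : ∀ d, [i + d] ∈ W → [i] ∈ W := by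
          intro d
          induction d with
          | zero => exact id
          | succ d ih => exact fun h => ih (HW.ch0 (i + d) (by omega) h)
        exact key (j - i) (by rwa [Nat.add_sub_cancel' hj])
    set WC : Finset (List ℕ) := (W.filter (fun u => u.head? = some i ∧ u.tail ≠ [])).image List.tail
      with hWC
    set WR : Finset (List ℕ) := W.filter (fun u => u.head? ≠ some i) with hWR
    have mC : ∀ u, u ∈ WC ↔ u ≠ [] ∧ i :: u ∈ W := by
      intro u
      simp only [hWC, Finset.mem_image, Finset.mem_filter]
      constructor
      · rintro ⟨v, ⟨h1, h2, h3⟩, rfl⟩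
        cases v with
        | nil => simp at h2
        | cons a v =>
          simp at h2; subst h2
          exact ⟨h3, h1⟩
      · rintro ⟨h1, h2⟩
        exact ⟨i :: u, ⟨h2, rfl, h1⟩, rfl⟩
    have mR : ∀ j u, j :: u ∈ WR ↔ j ≠ i ∧ j :: u ∈ W := by
      intro j u
      simp only [hWR, Finset.mem_filter, List.head?_cons, ne_eq, Option.some.injEq]
      tauto
    have nR : [] ∉ WR := fun h => HW.nil (Finset.mem_filter.1 h).1
    have cR : WR.card < W.card := by
      apply Finset.card_lt_card
      refine ⟨Finset.filter_subset _ _, fun h => ?_⟩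
      have := (mR i []).1 (h hiW)
      exact this.1 rfl
    have cC : WC.card < W.card := by
      refine lt_of_le_of_lt Finset.card_image_le (Finset.card_lt_card ?_)
      refine ⟨Finset.filter_subset _ _, fun h => ?_⟩
      have := (Finset.mem_filter.1 (h hiW)).2.2
      exact this rfl
    have HC : IsForest WC 1 := by
      refine ⟨fun h => ((mC _).1 h).1 rfl, ?_, ?_, ?_, ?_, ?_⟩
      · intro u v hu huv hv
        exact (mC _).2 ⟨hu, HW.pre _ (i :: v) (by simp)
          (by rw [List.cons_prefix_cons]; exact ⟨rfl, huv⟩) ((mC _).1 hv).2⟩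
      · intro u hu j hj
        exact HW.lab _ ((mC _).1 hu).2 j (List.mem_cons_of_mem _ hj)
      · intro j u hu
        exact HW.lab _ ((mC _).1 hu).2 j (by simp)
      · intro u j hu hj h
        exact (mC _).2 ⟨by simp, HW.ch (i :: u) j (by simp) hj ((mC _).1 h).2⟩
      · intro j hj h
        exact (mC _).2 ⟨by simp, HW.ch [i] j (by simp) hj ((mC _).1 h).2⟩
    have HR : IsForest WR (i + 1) := by
      refine ⟨nR, ?_, ?_, ?_, ?_, ?_⟩
      · intro u v hu huv hv
        cases u with
        | nil => exact absurd rfl hu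
        | cons a u =>
          cases v with
          | nil => simp at huv
          | cons b v =>
            have huv' := huv
            rw [List.cons_prefix_cons] at huv'
            obtain ⟨rfl, -⟩ := huv'
            rw [mR] at hv ⊢
            exact ⟨hv.1, HW.pre _ _ hu huv hv.2⟩
      · intro u hu j hj
        exact HW.lab _ (Finset.mem_filter.1 hu).1 j hj
      · intro j u hu
        have h1 := (mR _ _).1 hu
        have := HW.head _ _ h1.2
        omega
      · intro u j hu hj h
        cases u with
        | nil => exact absurd rfl hu
        | cons a u =>
          rw [List.cons_append, mR] at h ⊢
          exact ⟨h.1, HW.ch (a :: u) j hu hj h.2⟩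
      · intro j hj h
        rw [mR] at h ⊢
        exact ⟨by omega, HW.ch0 j (by omega) h.2⟩
    obtain ⟨C, hC⟩ := ih WC 1 (by omega) le_rfl HC
    obtain ⟨R, hR⟩ := ih WR (i + 1) (by omega) (by omega) HR
    refine ⟨Pf.cons C R, ?_⟩
    ext u
    cases u with
    | nil => simp [nil_notMem, HW.nil]
    | cons j u =>
      rw [mem_V_cons, hC, hR, mC, mR]
      by_cases hj : j = i
      · subst hj
        by_cases hu : u = []
        · subst hu; simp [hiW]
        · simp [hu]
      · simp [hj]

/-- number of children -/
noncomputable def K (W : Finset (List ℕ)) (u : List ℕ) : ℕ := Set.ncard {i : ℕ | u ++ [i] ∈ W}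

theorem K_nil {P : Pf} : ∀ i, K (V P i) [] = pln P := by
  induction P with
  | nil => intro i; simp [K, V, pln]
  | cons C R _ ih =>
    intro i
    have h1 : {j : ℕ | [] ++ [j] ∈ V (Pf.cons C R) i} =
        insert i {j : ℕ | [] ++ [j] ∈ V R (i + 1)} := by
      ext j
      simp only [List.nil_append, Set.mem_ofPred_eq, Set.mem_insert_iff, mem_V_cons]
      tauto
    have hfin : {j : ℕ | [] ++ [j] ∈ V R (i + 1)}.Finite :=
      Set.Finite.preimage (f := fun j : ℕ => ([] ++ [j] : List ℕ))
        (fun a _ b _ h => by simpa using h) (V R (i + 1)).finite_toSet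
    rw [K, h1, Set.ncard_insert_of_notMem _ hfin, pln, ← ih (i + 1), K]
    intro h
    have := head_le h
    omega

theorem K_eq {C R : Pf} {i : ℕ} (u : List ℕ) : K (V (Pf.cons C R) i) (i :: u) = K (V C 1) u := by
  simp only [K, List.cons_append, mem_V_eq]
  simp

theorem K_lt {C R : Pf} {i j : ℕ} (h : i < j) (u : List ℕ) :
    K (V (Pf.cons C R) i) (j :: u) = K (V R (i + 1)) (j :: u) := by
  simp only [K, List.cons_append, mem_V_lt h]

theorem V_disj (C R : Pf) (i : ℕ) :
    Disjoint ((insert [] (V C 1)).image (List.cons i)) (V R (i + 1)) := by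
  rw [Finset.disjoint_left]
  intro u hu hu'
  obtain ⟨v, -, rfl⟩ := Finset.mem_image.1 hu
  have := head_le hu'
  omega

theorem V_card {P : Pf} : ∀ i, (V P i).card = psz P := by
  induction P with
  | nil => intro i; rfl
  | cons C R hC hR =>
    intro i
    rw [V, Finset.card_union_of_disjoint (V_disj C R i),
      Finset.card_image_of_injective _ List.cons_injective,
      Finset.card_insert_of_notMem (nil_notMem _ _), hC, hR, psz]
    omega

theorem V_prod {P : Pf} : ∀ i, ∏ u ∈ V P i, (K (V P i) u + 1) = pw P := by
  induction P with
  | nil => intro i; rfl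
  | cons C R hC hR =>
    intro i
    have e1 : ∏ u ∈ V R (i + 1), (K (V (Pf.cons C R) i) u + 1) = pw R := by
      rw [← hR (i + 1)]
      refine Finset.prod_congr rfl fun u hu => ?_
      cases u with
      | nil => exact absurd hu (nil_notMem _ _)
      | cons j u => rw [K_lt]; have := head_le hu; omega
    have e2 : ∏ u ∈ (insert [] (V C 1)).image (List.cons i), (K (V (Pf.cons C R) i) u + 1) =
        (pln C + 1) * pw C := by
      rw [Finset.prod_image (fun a _ b _ h => List.cons_injective h),
        Finset.prod_insert (nil_notMem _ _), K_eq, K_nil, ← hC 1]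
      congr 1
      exact Finset.prod_congr rfl fun u _ => by rw [K_eq]
    have e3 : V (Pf.cons C R) i = (insert [] (V C 1)).image (List.cons i) ∪ V R (i + 1) := rfl
    conv_lhs => rw [Finset.prod_congr e3 (fun _ _ => rfl)]
    rw [Finset.prod_union (V_disj C R i), e1, e2, pw]

theorem V_deg {A : Set ℕ} {P : Pf} : ∀ i, (∀ u ∈ V P i, K (V P i) u + 1 ∈ A) ↔ PD A P := by
  induction P with
  | nil => intro i; simp [V, PD]
  | cons C R hC hR =>
    intro i
    rw [PD, ← hC 1, ← hR (i + 1)]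
    constructor
    · intro h
      refine ⟨?_, fun u hu => ?_, fun u hu => ?_⟩
      · have := h [i] (mem_V_eq.2 (Or.inl rfl))
        rwa [K_eq, K_nil] at this
      · have := h (i :: u) (mem_V_eq.2 (Or.inr hu))
        rwa [K_eq] at this
      · cases u with
        | nil => exact absurd hu (nil_notMem _ _)
        | cons j u =>
          have hj : i < j := head_le hu
          have := h (j :: u) ((mem_V_lt hj).2 hu)
          rwa [K_lt hj] at this
    · rintro ⟨h1, h2, h3⟩ u hu
      cases u with
      | nil => exact absurd hu (nil_notMem _ _)
      | cons j u =>
        rcases mem_V_cons.1 hu with ⟨rfl, rfl | h⟩ | h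
        · rw [K_eq, K_nil]; exact h1
        · rw [K_eq]; exact h2 u h
        · rw [K_lt (head_le h)]; exact h3 _ h

def toPT (P : Pf) : PlaneTree where
  verts := insert [] (V P 1)
  root_mem := by simp
  prefix_closed := by
    intro u v huv hv
    rw [Finset.mem_insert] at hv ⊢
    by_cases hu : u = []
    · exact Or.inl hu
    · rcases hv with rfl | hv
      · simp at huv; exact Or.inl huv
      · exact Or.inr ((V_forest le_rfl).pre u v hu huv hv)
  labels_pos := by
    intro u hu
    rcases Finset.mem_insert.1 hu with rfl | hu
    · simp
    · exact (V_forest le_rfl).lab u hu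
  children_closed := by
    intro u i hi h
    rw [Finset.mem_insert] at h ⊢
    rcases h with h | h
    · simp at h
    · right
      by_cases hu : u = []
      · subst hu; exact (V_forest le_rfl).ch0 i hi h
      · exact (V_forest le_rfl).ch u i hu hi h

theorem toPT_kc (P : Pf) (u : List ℕ) : (toPT P).kc u = K (V P 1) u := by
  simp only [PlaneTree.kc, K, toPT, Finset.mem_insert]
  simp

theorem PT_ext {τ τ' : PlaneTree} (h : τ.verts = τ'.verts) : τ = τ' := by
  cases τ; cases τ'; simp only at h; subst h; rfl

theorem toPT_bij : Function.Bijective toPT := by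
  constructor
  · intro P P' h
    have h1 : insert [] (V P 1) = insert [] (V P' 1) := congrArg PlaneTree.verts h
    apply V_inj (i := 1)
    rw [← Finset.erase_insert (nil_notMem P 1), h1, Finset.erase_insert (nil_notMem P' 1)]
  · intro τ
    obtain ⟨P, hP⟩ := V_surj _ (τ.verts.erase []) 1 le_rfl le_rfl (by
      refine ⟨by simp, ?_, ?_, ?_, ?_, ?_⟩
      · intro u v hu huv hv
        exact Finset.mem_erase.2 ⟨hu, τ.prefix_closed u v huv (Finset.mem_erase.1 hv).2⟩
      · intro u hu
        exact τ.labels_pos u (Finset.mem_erase.1 hu).2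
      · intro j u hu
        exact τ.labels_pos _ (Finset.mem_erase.1 hu).2 j (by simp)
      · intro u j _ hj h
        exact Finset.mem_erase.2 ⟨by simp, τ.children_closed u j hj (Finset.mem_erase.1 h).2⟩
      · intro j hj h
        exact Finset.mem_erase.2 ⟨by simp, τ.children_closed [] j hj (Finset.mem_erase.1 h).2⟩)
    refine ⟨P, PT_ext ?_⟩
    show insert [] (V P 1) = τ.verts
    rw [hP, Finset.insert_erase τ.root_mem]

theorem plane_sum (A : Set ℕ) (m : ℕ) :
    ∑ᶠ P ∈ {P : Pf | psz P = m ∧ pln P ∈ A ∧ PD A P}, pw P =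
      ∑ᶠ τ ∈ {τ : PlaneTree | τ.verts.card = m + 1 ∧ τ.kc [] ∈ A ∧
          ∀ u ∈ τ.verts, u ≠ [] → τ.kc u + 1 ∈ A},
        ∏ u ∈ τ.verts.erase [], (τ.kc u + 1) := by
  have hmem : ∀ P, (psz P = m ∧ pln P ∈ A ∧ PD A P) ↔ ((toPT P).verts.card = m + 1 ∧
      (toPT P).kc [] ∈ A ∧ ∀ u ∈ (toPT P).verts, u ≠ [] → (toPT P).kc u + 1 ∈ A) := by
    intro P
    have e1 : (toPT P).verts.card = psz P + 1 := by
      show (insert [] (V P 1)).card = _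
      rw [Finset.card_insert_of_notMem (nil_notMem _ _), V_card]
    have e2 : (∀ u ∈ (toPT P).verts, u ≠ [] → (toPT P).kc u + 1 ∈ A) ↔ PD A P := by
      rw [← V_deg 1]
      constructor
      · intro h u hu
        rw [← toPT_kc]
        exact h u (Finset.mem_insert_of_mem hu) (by rintro rfl; exact nil_notMem _ _ hu)
      · intro h u hu hne
        rw [toPT_kc]
        exact h u ((Finset.mem_insert.1 hu).resolve_left hne)
    rw [e1, e2, toPT_kc, K_nil]
    simp
  refine finsum_mem_eq_of_bijOn toPT ⟨fun P hP => (hmem P).1 hP, toPT_bij.1.injOn, ?_⟩ ?_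
  · intro τ hτ
    obtain ⟨P, rfl⟩ := toPT_bij.2 τ
    exact ⟨P, (hmem P).2 hτ, rfl⟩
  · intro P _
    have : (toPT P).verts.erase [] = V P 1 := Finset.erase_insert (nil_notMem P 1)
    rw [this, ← V_prod 1]
    exact Finset.prod_congr rfl fun u _ => by rw [toPT_kc]

end NCProof

namespace NCProof

open Relation

def gr (F : Fo) (m : ℕ) (h : sz F = m) : SimpleGraph (Fin (m + 1)) where
  Adj x y := Ad F 1 0 x.1 y.1
  symm := ⟨fun x y h => h.symm⟩
  loopless := ⟨fun x hx => by
    rcases hx with hx | hx <;> exact Ed_ne (by omega) hx rfl⟩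

theorem gr_connected (F : Fo) (m : ℕ) (h : sz F = m) : (gr F m h).Connected := by
  have key : ∀ x, ReflTransGen (Ad F 1 0) x 0 → ∀ hx : x < m + 1,
      (gr F m h).Reachable ⟨x, hx⟩ 0 := by
    intro x hr
    induction hr using ReflTransGen.head_induction_on with
    | refl => intro hx; exact SimpleGraph.Reachable.refl _
    | head h1 h2 ih =>
      rename_i a b
      intro hx
      have hb : b < m + 1 := by have := suppA h1; omega
      have hadj : (gr F m h).Adj ⟨a, hx⟩ ⟨b, hb⟩ := h1
      exact hadj.reachable.trans (ih hb)
  have key2 : ∀ x : Fin (m + 1), (gr F m h).Reachable x 0 := by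
    intro x
    refine key x.1 ?_ x.2
    by_cases hx : x.1 = 0
    · rw [hx]
    · exact Ad_reach (by omega) (by omega)
  haveI : Nonempty (Fin (m + 1)) := ⟨0⟩
  exact ⟨fun x y => (key2 x).trans (key2 y).symm⟩

theorem gr_card (F : Fo) (m : ℕ) (h : sz F = m) : Nat.card (gr F m h).edgeSet ≤ m := by
  have h1 := Ed_card (F := F) 1 0
  have hfin : {q : ℕ × ℕ | Ed F 1 0 q.1 q.2}.Finite :=
    Set.finite_of_encard_le_coe h1
  have h2 : {q : ℕ × ℕ | Ed F 1 0 q.1 q.2}.ncard ≤ m := by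
    rw [← h]
    have := hfin.cast_ncard_eq
    rw [← this] at h1
    exact_mod_cast h1
  have hinj : Function.Injective (Sym2.map (Fin.val : Fin (m + 1) → ℕ)) :=
    Sym2.map.injective Fin.val_injective
  rw [Nat.card_coe_set_eq, ← Set.ncard_image_of_injective _ hinj]
  refine le_trans (Set.ncard_le_ncard ?_ (hfin.image (fun q : ℕ × ℕ => s(q.1, q.2))))
    ((Set.ncard_image_le hfin).trans h2)
  rintro e ⟨f, hf, rfl⟩
  induction f using Sym2.ind with
  | _ x y =>
    have hf' : Ad F 1 0 x.1 y.1 := hf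
    rcases hf' with hf' | hf'
    · exact ⟨(x.1, y.1), hf', rfl⟩
    · exact ⟨(y.1, x.1), hf', Sym2.eq_swap⟩

theorem gr_isTree (F : Fo) (m : ℕ) (h : sz F = m) : (gr F m h).IsTree := by
  rw [SimpleGraph.isTree_iff_connected_and_card]
  refine ⟨gr_connected F m h, ?_⟩
  have h1 := (gr_connected F m h).card_vert_le_card_edgeSet_add_one
  have h2 := gr_card F m h
  simp only [Nat.card_eq_fintype_card, Fintype.card_fin] at h1 h2 ⊢
  omega

def toNC (F : Fo) (m : ℕ) (h : sz F = m) : NCTree (m + 1) where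
  adj := gr F m h
  isTree := gr_isTree F m h
  noncrossing := by
    intro a b c d hab hcd hne z hz
    obtain ⟨hz1, hz2⟩ := hz
    have ho : (0 < 1 ∨ 1 + sz F ≤ 0) := by omega
    have hab' : Ad F 1 0 a.1 b.1 := hab
    have hcd' : Ad F 1 0 c.1 d.1 := hcd
    have nab : a.1 ≠ b.1 := fun h => hab.ne (Fin.ext h)
    have ncd : c.1 ≠ d.1 := fun h => hcd.ne (Fin.ext h)
    have hne1 : ¬ (c.1 = a.1 ∧ d.1 = b.1) := by
      rintro ⟨h1, h2⟩; exact hne (by rw [h1, h2])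
    have hne2 : ¬ (c.1 = b.1 ∧ d.1 = a.1) := by
      rintro ⟨h1, h2⟩; exact hne (by rw [h1, h2, Set.pair_comm])
    have n1 := Ad_nc ho hab' hcd'
    have n2 := Ad_nc ho hab' hcd'.symm
    have n3 := Ad_nc ho hab'.symm hcd'
    have n4 := Ad_nc ho hab'.symm hcd'.symm
    have n5 := Ad_nc ho hcd' hab'
    have n6 := Ad_nc ho hcd' hab'.symm
    have n7 := Ad_nc ho hcd'.symm hab'
    have n8 := Ad_nc ho hcd'.symm hab'.symm
    rcases lt_or_gt_of_ne nab with hlt | hlt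
    · exact geom_nc hlt b.2 c.2 d.2 ncd ⟨hne1, hne2⟩ (by omega) hz1 hz2
    · rw [segment_symm] at hz1
      have := geom_nc hlt a.2 c.2 d.2 ncd ⟨by omega, by omega⟩ (by omega) hz1 hz2
      exact ⟨this.1.symm, this.2⟩

theorem NC_ext {n : ℕ} {θ θ' : NCTree n} (h : θ.adj = θ'.adj) : θ = θ' := by
  cases θ; cases θ'; simp only at h; subst h; rfl

theorem toNC_surj (m : ℕ) (θ : NCTree (m + 1)) : ∃ F, ∃ h : sz F = m, toNC F m h = θ := by
  set G : ℕ → ℕ → Prop := fun x y => ∃ (hx : x < m + 1) (hy : y < m + 1),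
    θ.adj.Adj ⟨x, hx⟩ ⟨y, hy⟩ with hG
  obtain ⟨F, hF, hsub⟩ := exists_Fo m 1 0 G
    (fun x y ⟨hx, hy, h⟩ => ⟨hy, hx, h.symm⟩) (by omega)
    (by
      rintro a b c d ⟨ha, hb, hab⟩ ⟨hc, hd, hcd⟩ ⟨h1, h2, h3⟩
      obtain ⟨z, hz1, hz2, hz3, hz4⟩ := geom_cross h1 h2 h3 hd
      have hne : ({a, b} : Set ℕ) ≠ {c, d} := by
        intro h
        have : a ∈ ({c, d} : Set ℕ) := by rw [← h]; simp
        simp only [Set.mem_insert_iff, Set.mem_singleton_iff] at this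
        omega
      have := θ.noncrossing _ _ _ _ hab hcd hne ⟨hz1, hz2⟩
      rcases this.1 with h | h
      · exact hz3 h
      · exact hz4 h)
    (by
      rintro x y ⟨hx, hy, h⟩
      omega)
    (by
      intro x hx hx'
      obtain ⟨w⟩ := θ.isTree.1.preconnected ⟨x, by omega⟩ 0
      have key : ∀ {u v : Fin (m + 1)}, θ.adj.Walk u v → ReflTransGen G u.1 v.1 := by
        intro u v w
        induction w with
        | nil => exact ReflTransGen.refl
        | cons hadj _ ih => exact ReflTransGen.head ⟨Fin.is_lt _, Fin.is_lt _, hadj⟩ ih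
      exact key w)
  refine ⟨F, hF, NC_ext ?_⟩
  have hle : gr F m hF ≤ θ.adj := by
    intro x y hxy
    have hxy' : Ad F 1 0 x.1 y.1 := hxy
    rcases hxy' with h | h
    · obtain ⟨_, _, h⟩ := hsub _ _ h
      exact h
    · obtain ⟨_, _, h⟩ := hsub _ _ h
      exact h.symm
  exact le_antisymm hle
    ((SimpleGraph.isTree_iff_minimal_connected.1 θ.isTree).2 (gr_connected F m hF) hle)

theorem toNC_deg (A : Set ℕ) (F : Fo) (m : ℕ) (h : sz F = m) :
    (∀ v, ncDeg (m + 1) (toNC F m h) v ∈ A) ↔ ln F ∈ A ∧ Dg A F := by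
  have ho : (0 < 1 ∨ 1 + sz F ≤ 0) := by omega
  have e : ∀ v : Fin (m + 1), ncDeg (m + 1) (toNC F m h) v = {y | Ad F 1 0 v.1 y}.ncard := by
    intro v
    rw [ncDeg, ← Set.ncard_image_of_injective _ Fin.val_injective]
    congr 1
    ext y
    constructor
    · rintro ⟨w, hw, rfl⟩
      exact hw
    · intro hy
      have hy' : Ad F 1 0 v.1 y := hy
      have := suppA hy'
      exact ⟨⟨y, by omega⟩, hy, rfl⟩
  simp only [e]
  rw [deg_all (s := 1) (p := 0) ho, ← deg_p (s := 1) (p := 0) ho]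
  constructor
  · intro H
    exact ⟨H 0, fun x hx hx' => H ⟨x, by omega⟩⟩
  · rintro ⟨H1, H2⟩ v
    by_cases hv : v.1 = 0
    · rw [hv]; exact H1
    · exact H2 _ (by omega) (by omega)

theorem count_NC (A : Set ℕ) (m : ℕ) :
    Nat.card {θ : NCTree (m + 1) // ∀ v : Fin (m + 1), ncDeg (m + 1) θ v ∈ A} =
      Nat.card {F : Fo // sz F = m ∧ ln F ∈ A ∧ Dg A F} := by
  symm
  refine Nat.card_congr (Equiv.ofBijective
    (fun F => ⟨toNC F.1 m F.2.1, (toNC_deg A F.1 m F.2.1).2 F.2.2⟩) ⟨?_, ?_⟩)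
  · rintro ⟨F, h, hF⟩ ⟨F', h', hF'⟩ he
    have he1 : gr F m h = gr F' m h' := congrArg (fun θ => θ.1.adj) he
    have : F = F' := by
      apply Fo_inj (s := 1) (p := 0) (by omega) (by omega)
      intro x y
      constructor
      · intro hxy
        have hs := suppA hxy
        have h1 : (gr F m h).Adj ⟨x, by omega⟩ ⟨y, by omega⟩ := hxy
        rw [he1] at h1
        exact h1
      · intro hxy
        have hs := suppA hxy
        have h1 : (gr F' m h').Adj ⟨x, by omega⟩ ⟨y, by omega⟩ := hxy
        rw [← he1] at h1
        exact h1
    subst this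
    rfl
  · rintro ⟨θ, hθ⟩
    obtain ⟨F, h, rfl⟩ := toNC_surj m θ
    exact ⟨⟨F, h, (toNC_deg A F m h).1 hθ⟩, rfl⟩

end NCProof

/-- Let `A ⊆ {1,2,…}` with `1 ∈ A`. For every `n ≥ 1`, the number of
noncrossing trees with `n` vertices all of whose vertex degrees belong to `A` equals
`Σ_{τ ∈ T_n^A} ∏_{u ≠ root} (k_u(τ) + 1)`, where `T_n^A` is the set of plane trees with `n`
vertices whose root has `k_∅(τ) ∈ A` children and whose non-root vertices `u` satisfy
`k_u(τ) + 1 ∈ A`. -/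
theorem card_degree_constrained_ncTree (A : Set ℕ) (hA1 : 1 ∈ A) (hApos : ∀ a ∈ A, 1 ≤ a)
    (n : ℕ) (hn : 1 ≤ n) :
    (Nat.card {θ : NCTree n // ∀ v : Fin n, ncDeg n θ v ∈ A} : ℕ) =
      ∑ᶠ τ ∈ {τ : PlaneTree | τ.verts.card = n ∧ τ.kc [] ∈ A ∧
          ∀ u ∈ τ.verts, u ≠ [] → τ.kc u + 1 ∈ A},
        ∏ u ∈ τ.verts.erase [], (τ.kc u + 1) := by
  obtain ⟨m, rfl⟩ : ∃ m, n = m + 1 := ⟨n - 1, by omega⟩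
  rw [NCProof.count_NC, NCProof.count_Fo, NCProof.plane_sum]
end

section
/- Let μ_∅ be a probability measure on ℕ with finite mean and μ a critical aperiodic probability measure on ℤ₊ with finite variance σ² > 0. Then BGW^{μ_∅,μ}(T_n) ~ (Σ_{k≥1} k μ_∅(k)) / (σ·sqrt(2π)) · n^{−3/2} as n → ∞, where BGW^{μ_∅,μ}(T_n) is the total mass given by the modified Bienaymé–Galton–Watson measure to plane trees with n vertices. -/
open Filter Set

noncomputable section

namespace PlaneTree

/-- `M(τ)`: the size of the largest subtree grafted on a child of the root of `τ`. -/
def maxSub (τ : PlaneTree) : ℕ := (Finset.Icc 1 (τ.kc [])).sup fun i => τ.subtreeSize [i]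

end PlaneTree

/-- The Bienaymé–Galton–Watson weight `BGW^μ(τ) = ∏_{u ∈ τ} μ(k_u)` of a plane tree. -/
def bgwW (μ : ℕ → ℝ) (τ : PlaneTree) : ℝ := ∏ u ∈ τ.verts, μ (τ.kc u)

/-- The modified Bienaymé–Galton–Watson weight of a plane tree: the root reproduces according
to `μ0` and the other vertices according to `μ`. -/
def bgwModW (μ0 μ : ℕ → ℝ) (τ : PlaneTree) : ℝ :=
  μ0 (τ.kc []) * ∏ u ∈ τ.verts.erase [], μ (τ.kc u)

/-- The total mass `BGW^{μ0,μ}(T_n)` given by the modified Bienaymé–Galton–Watson measure to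
plane trees with `n` vertices. -/
def bgwModMass (μ0 μ : ℕ → ℝ) (n : ℕ) : ℝ :=
  ∑ᶠ τ ∈ {τ : PlaneTree | τ.verts.card = n}, bgwModW μ0 μ τ

/-- `μ` belongs to the domain of attraction of a stable law of index `α ∈ (1,2]`: either
`α = 2` and `μ` has finite variance, or `α < 2` and the tail `μ([n,∞))` equals `g(n) n^{-α}`
for a slowly varying function `g`. -/
def DomAttr (μ : ℕ → ℝ) (α : ℝ) : Prop :=
  (α = 2 ∧ Summable fun k : ℕ => (k : ℝ) ^ 2 * μ k) ∨
  (α < 2 ∧ ∃ g : ℝ → ℝ, (∀ x : ℝ, 0 < x → 0 < g x) ∧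
    (∀ c : ℝ, 0 < c → Tendsto (fun x => g (c * x) / g x) atTop (nhds 1)) ∧
    ∀ n : ℕ, 1 ≤ n → (∑' k : ℕ, {m : ℕ | n ≤ m}.indicator μ k) = g n * (n : ℝ) ^ (-α))


theorem PlaneTree.ext' {τ τ' : PlaneTree} (h : τ.verts = τ'.verts) : τ = τ' := by
  cases τ; cases τ'; simp_all

theorem eq_Icc_ncard (S : Set ℕ) (hf : S.Finite) (hpos : ∀ i ∈ S, 1 ≤ i)
    (hd : ∀ i, 1 ≤ i → i + 1 ∈ S → i ∈ S) (i : ℕ) : i ∈ S ↔ 1 ≤ i ∧ i ≤ S.ncard := by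
  have hd2 : ∀ d i, 1 ≤ i → i + d ∈ S → i ∈ S := by
    intro d
    induction d with
    | zero => intro i _ h; simpa using h
    | succ d ih => intro i hi h; exact ih i hi (hd _ (by omega) h)
  have key : S = ((Finset.Icc 1 (hf.toFinset.sup id) : Finset ℕ) : Set ℕ) := by
    ext j
    simp only [Finset.coe_Icc, Set.mem_Icc]
    constructor
    · intro hj
      exact ⟨hpos j hj, Finset.le_sup (f := id) (hf.mem_toFinset.2 hj)⟩
    · rintro ⟨h1, h2⟩
      have hne : hf.toFinset.Nonempty := by
        by_contra hne
        rw [Finset.not_nonempty_iff_eq_empty] at hne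
        rw [hne] at h2
        simp at h2
        omega
      obtain ⟨x, hx, hx2⟩ := Finset.exists_mem_eq_sup _ hne (id : ℕ → ℕ)
      rw [hx2] at h2
      simp only [id] at h2
      have hx' := hf.mem_toFinset.1 hx
      exact hd2 (x - j) j h1 (by rwa [Nat.add_sub_cancel' h2])
  have hc : S.ncard = hf.toFinset.sup id := by
    conv_lhs => rw [key]
    rw [Set.ncard_coe_finset]; simp
  rw [hc]
  conv_lhs => rw [key]
  simp

theorem PlaneTree.mem_iff_kc (τ : PlaneTree) (u : List ℕ) (i : ℕ) :
    u ++ [i] ∈ τ.verts ↔ 1 ≤ i ∧ i ≤ τ.kc u := by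
  refine eq_Icc_ncard {i : ℕ | u ++ [i] ∈ τ.verts} ?_ ?_ ?_ i
  · refine Set.Finite.preimage (f := fun i : ℕ => u ++ [i]) ?_ τ.verts.finite_toSet
    intro a _ b _ h
    simpa using h
  · intro i hi
    exact τ.labels_pos _ hi i (by simp)
  · intro i hi h
    exact τ.children_closed u i hi h

/-- Vertices of the tree obtained by grafting trees on a root. -/
def joinVerts (k : ℕ) (f : Fin k → PlaneTree) : Finset (List ℕ) :=
  Finset.univ.biUnion fun i : Fin k => (f i).verts.image (List.cons (i.1 + 1))

theorem mem_joinVerts (k : ℕ) (f : Fin k → PlaneTree) (v : List ℕ) :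
    v ∈ joinVerts k f ↔ ∃ i : Fin k, ∃ w ∈ (f i).verts, (i.1 + 1) :: w = v := by
  simp [joinVerts]

theorem nil_not_mem_joinVerts (k : ℕ) (f : Fin k → PlaneTree) : [] ∉ joinVerts k f := by
  simp [mem_joinVerts]

/-- Grafting trees on a root. -/
def joinTree (k : ℕ) (f : Fin k → PlaneTree) : PlaneTree where
  verts := insert [] (joinVerts k f)
  root_mem := by simp
  prefix_closed := by
    intro u v huv hv
    rw [Finset.mem_insert, mem_joinVerts] at hv ⊢
    rcases hv with rfl | ⟨i, w, hw, rfl⟩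
    · left; simpa using huv
    · rw [List.prefix_cons_iff] at huv
      rcases huv with rfl | ⟨t, rfl, ht⟩
      · left; rfl
      · right; exact ⟨i, t, (f i).prefix_closed _ _ ht hw, rfl⟩
  labels_pos := by
    intro u hu
    rw [Finset.mem_insert, mem_joinVerts] at hu
    rcases hu with rfl | ⟨i, w, hw, rfl⟩
    · simp
    · intro j hj
      rcases List.mem_cons.1 hj with rfl | hj
      · omega
      · exact (f i).labels_pos w hw j hj
  children_closed := by
    intro u i hi hu
    rw [Finset.mem_insert, mem_joinVerts] at hu ⊢
    right
    rcases hu with h | ⟨j, w, hw, h⟩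
    · simp at h
    · cases u with
      | nil =>
        simp only [List.nil_append, List.cons.injEq] at h
        obtain ⟨h1, rfl⟩ := h
        refine ⟨⟨i - 1, by omega⟩, [], (f _).root_mem, ?_⟩
        simp; omega
      | cons a u =>
        simp only [List.cons_append, List.cons.injEq] at h
        obtain ⟨h1, rfl⟩ := h
        exact ⟨j, u ++ [i], (f j).children_closed _ _ hi hw, by simp [h1]⟩

theorem mem_joinTree (k : ℕ) (f : Fin k → PlaneTree) (v : List ℕ) :
    v ∈ (joinTree k f).verts ↔ v = [] ∨ ∃ i : Fin k, ∃ w ∈ (f i).verts, (i.1 + 1) :: w = v := by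
  show v ∈ insert [] (joinVerts k f) ↔ _
  rw [Finset.mem_insert, mem_joinVerts]

theorem cons_mem_joinTree (k : ℕ) (f : Fin k → PlaneTree) (i : Fin k) (v : List ℕ) :
    (i.1 + 1) :: v ∈ (joinTree k f).verts ↔ v ∈ (f i).verts := by
  rw [mem_joinTree]
  constructor
  · rintro (h | ⟨j, w, hw, h⟩)
    · simp at h
    · simp only [List.cons.injEq, add_left_inj] at h
      obtain ⟨h1, rfl⟩ := h
      rwa [← Fin.ext h1]
  · intro h
    exact Or.inr ⟨i, v, h, rfl⟩

theorem kc_joinTree_cons (k : ℕ) (f : Fin k → PlaneTree) (i : Fin k) (v : List ℕ) :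
    (joinTree k f).kc ((i.1 + 1) :: v) = (f i).kc v := by
  unfold PlaneTree.kc
  congr 1
  ext j
  simp only [Set.mem_ofPred_eq, List.cons_append]
  exact cons_mem_joinTree k f i _

theorem kc_joinTree_nil (k : ℕ) (f : Fin k → PlaneTree) : (joinTree k f).kc [] = k := by
  have h : ∀ i, (1 ≤ i ∧ i ≤ (joinTree k f).kc []) ↔ (1 ≤ i ∧ i ≤ k) := by
    intro i
    rw [← PlaneTree.mem_iff_kc, List.nil_append, mem_joinTree]
    constructor
    · rintro (h | ⟨j, w, hw, h⟩)
      · simp at h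
      · simp only [List.cons.injEq] at h
        omega
    · rintro ⟨h1, h2⟩
      exact Or.inr ⟨⟨i - 1, by omega⟩, [], (f _).root_mem, by simp; omega⟩
  have h1 := h k
  have h2 := h ((joinTree k f).kc [])
  omega

theorem joinTree_erase (k : ℕ) (f : Fin k → PlaneTree) :
    (joinTree k f).verts.erase [] = joinVerts k f :=
  Finset.erase_insert (nil_not_mem_joinVerts k f)

theorem joinVerts_disj (k : ℕ) (f : Fin k → PlaneTree) :
    Set.PairwiseDisjoint ((Finset.univ : Finset (Fin k)) : Set (Fin k))
      (fun i : Fin k => (f i).verts.image (List.cons (i.1 + 1))) := by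
  intro i _ j _ hij
  rw [Function.onFun, Finset.disjoint_left]
  intro v hv hv'
  simp only [Finset.mem_image] at hv hv'
  obtain ⟨a, _, rfl⟩ := hv
  obtain ⟨b, _, hb⟩ := hv'
  simp only [List.cons.injEq, add_left_inj] at hb
  exact hij (Fin.ext hb.1.symm)

theorem card_joinTree (k : ℕ) (f : Fin k → PlaneTree) :
    (joinTree k f).verts.card = (∑ i, (f i).verts.card) + 1 := by
  show (insert [] (joinVerts k f)).card = _
  rw [Finset.card_insert_of_notMem (nil_not_mem_joinVerts k f), joinVerts,
    Finset.card_biUnion (joinVerts_disj k f)]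
  congr 1
  refine Finset.sum_congr rfl fun i _ => ?_
  exact Finset.card_image_of_injective _ List.cons_injective

theorem bgwModW_self (μ : ℕ → ℝ) (τ : PlaneTree) : bgwModW μ μ τ = bgwW μ τ := by
  unfold bgwModW bgwW
  exact Finset.mul_prod_erase τ.verts (fun u => μ (τ.kc u)) τ.root_mem

theorem bgwModW_joinTree (μ0 μ : ℕ → ℝ) (k : ℕ) (f : Fin k → PlaneTree) :
    bgwModW μ0 μ (joinTree k f) = μ0 k * ∏ i, bgwModW μ μ (f i) := by
  simp only [bgwModW_self]
  unfold bgwModW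
  rw [kc_joinTree_nil, joinTree_erase, joinVerts, Finset.prod_biUnion (joinVerts_disj k f)]
  congr 1
  refine Finset.prod_congr rfl fun i _ => ?_
  rw [Finset.prod_image (fun a _ b _ h => List.cons_injective h)]
  unfold bgwW
  refine Finset.prod_congr rfl fun v _ => ?_
  rw [kc_joinTree_cons]

/-- The subtree grafted on the child `i` of the root. -/
def subTree (τ : PlaneTree) (i : ℕ) (hi : [i] ∈ τ.verts) : PlaneTree where
  verts := τ.verts.preimage (List.cons i) List.cons_injective.injOn
  root_mem := by simpa using hi
  prefix_closed := by
    intro u v huv hv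
    rw [Finset.mem_preimage] at hv ⊢
    exact τ.prefix_closed _ _ (by simpa using huv) hv
  labels_pos := by
    intro u hu j hj
    rw [Finset.mem_preimage] at hu
    exact τ.labels_pos _ hu j (List.mem_cons_of_mem _ hj)
  children_closed := by
    intro u j hj hu
    rw [Finset.mem_preimage] at hu ⊢
    exact τ.children_closed (i :: u) j hj hu

theorem joinTree_surj (τ : PlaneTree) :
    ∃ f : Fin (τ.kc []) → PlaneTree, joinTree (τ.kc []) f = τ := by
  have hm : ∀ i : Fin (τ.kc []), [i.1 + 1] ∈ τ.verts := by
    intro i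
    have := (τ.mem_iff_kc [] (i.1 + 1)).2 ⟨by omega, by omega⟩
    simpa using this
  refine ⟨fun i => subTree τ (i.1 + 1) (hm i), ?_⟩
  apply PlaneTree.ext'
  ext v
  rw [mem_joinTree]
  constructor
  · rintro (rfl | ⟨i, w, hw, rfl⟩)
    · exact τ.root_mem
    · exact (Finset.mem_preimage (hf := List.cons_injective.injOn)).1 hw
  · intro hv
    cases v with
    | nil => left; rfl
    | cons a w =>
      right
      have ha : [a] ∈ τ.verts := τ.prefix_closed [a] (a :: w) (by simp) hv
      have := (τ.mem_iff_kc [] a).1 (by simpa using ha)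
      obtain ⟨b, rfl⟩ : ∃ b, a = b + 1 := ⟨a - 1, by omega⟩
      exact ⟨⟨b, by omega⟩, w, (Finset.mem_preimage (hf := List.cons_injective.injOn)).2 hv, rfl⟩

theorem joinTree_inj {k k' : ℕ} {f : Fin k → PlaneTree} {f' : Fin k' → PlaneTree}
    (h : joinTree k f = joinTree k' f') : (⟨k, f⟩ : Σ k, Fin k → PlaneTree) = ⟨k', f'⟩ := by
  have hk : k = k' := by rw [← kc_joinTree_nil k f, h, kc_joinTree_nil]
  subst hk
  congr 1
  funext i
  apply PlaneTree.ext'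
  ext v
  rw [← cons_mem_joinTree, h, cons_mem_joinTree]

theorem PlaneTree.card_pos (τ : PlaneTree) : 0 < τ.verts.card :=
  Finset.card_pos.2 ⟨_, τ.root_mem⟩

theorem sum_card_ge {k : ℕ} (f : Fin k → PlaneTree) : k ≤ ∑ i, (f i).verts.card := by
  calc k = ∑ _i : Fin k, 1 := by simp
    _ ≤ _ := Finset.sum_le_sum fun i _ => (f i).card_pos

theorem card_le_sum {k : ℕ} (f : Fin k → PlaneTree) (i : Fin k) :
    (f i).verts.card ≤ ∑ i, (f i).verts.card :=
  Finset.single_le_sum (f := fun i => (f i).verts.card) (fun _ _ => Nat.zero_le _) (Finset.mem_univ i)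

theorem finite_trees (N : ℕ) : {τ : PlaneTree | τ.verts.card ≤ N}.Finite := by
  induction N with
  | zero =>
    convert Set.finite_empty
    ext τ
    have := τ.card_pos
    simp only [Set.mem_ofPred_eq, Set.mem_empty_iff_false, iff_false]
    omega
  | succ N ih =>
    have h : (⋃ k ∈ (Finset.range (N + 1)), joinTree k ''
        (Set.pi Set.univ fun _ : Fin k => {τ : PlaneTree | τ.verts.card ≤ N})).Finite := by
      refine Set.Finite.biUnion (Finset.finite_toSet _) fun k _ => ?_
      exact (Set.Finite.pi fun _ => ih).image _
    refine h.subset ?_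
    intro τ hτ
    obtain ⟨f, hf⟩ := joinTree_surj τ
    have hc := card_joinTree _ f
    rw [hf] at hc
    have h1 := sum_card_ge f
    simp only [Set.mem_ofPred_eq] at hτ
    simp only [Set.mem_iUnion]
    refine ⟨τ.kc [], Finset.mem_range.2 (by omega), f, ?_, hf⟩
    intro i _
    have := card_le_sum f i
    simp only [Set.mem_ofPred_eq]
    omega

/-- The finset of plane trees with at most `N` vertices. -/
def treesLE (N : ℕ) : Finset PlaneTree := (finite_trees N).toFinset

theorem mem_treesLE (N : ℕ) (τ : PlaneTree) : τ ∈ treesLE N ↔ τ.verts.card ≤ N := by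
  simp [treesLE]

theorem bgwModMass_eq (μ0 μ : ℕ → ℝ) {n N : ℕ} (h : n ≤ N) :
    bgwModMass μ0 μ n = ∑ τ ∈ (treesLE N).filter (fun τ => τ.verts.card = n), bgwModW μ0 μ τ := by
  unfold bgwModMass
  rw [finsum_mem_eq_sum_of_inter_support_eq]
  ext τ
  simp only [Set.mem_inter_iff, Set.mem_ofPred_eq, Finset.coe_filter, mem_treesLE]
  constructor
  · rintro ⟨h1, h2⟩; exact ⟨⟨by omega, h1⟩, h2⟩
  · rintro ⟨⟨_, h1⟩, h2⟩; exact ⟨h1, h2⟩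

/-- The generating function of trees. -/
def genF (μ : ℕ → ℝ) : PowerSeries ℝ := PowerSeries.mk (bgwModMass μ μ)

/-- Truncated generating function. -/
def genFt (μ : ℕ → ℝ) (N : ℕ) : PowerSeries ℝ :=
  ∑ τ ∈ treesLE N, PowerSeries.monomial τ.verts.card (bgwModW μ μ τ)

theorem genF_dvd (μ : ℕ → ℝ) (N : ℕ) :
    (PowerSeries.X : PowerSeries ℝ) ^ (N + 1) ∣ genF μ - genFt μ N := by
  rw [PowerSeries.X_pow_dvd_iff]
  intro m hm
  rw [map_sub, genF, PowerSeries.coeff_mk, genFt, map_sum, bgwModMass_eq μ μ (Nat.le_of_lt_succ hm),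
    Finset.sum_filter, sub_eq_zero]
  refine Finset.sum_congr rfl fun τ _ => ?_
  rw [PowerSeries.coeff_monomial]
  simp only [eq_comm]

theorem coeff_genF_pow (μ : ℕ → ℝ) (m k : ℕ) :
    PowerSeries.coeff m (genF μ ^ k) =
      ∑ f ∈ (Fintype.piFinset fun _ : Fin k => treesLE m).filter
        (fun f => ∑ i, (f i).verts.card = m), ∏ i, bgwModW μ μ (f i) := by
  have h : (PowerSeries.X : PowerSeries ℝ) ^ (m + 1) ∣ genF μ ^ k - genFt μ m ^ k :=
    (genF_dvd μ m).trans (sub_dvd_pow_sub_pow _ _ k)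
  rw [PowerSeries.X_pow_dvd_iff] at h
  have h2 := h m (Nat.lt_succ_self m)
  rw [map_sub, sub_eq_zero] at h2
  rw [h2]
  have h3 : genFt μ m ^ k = ∏ _i : Fin k, genFt μ m := by simp
  rw [h3]
  unfold genFt
  rw [Finset.prod_univ_sum, map_sum, Finset.sum_filter]
  refine Finset.sum_congr rfl fun f _ => ?_
  rw [PowerSeries.prod_monomial, PowerSeries.coeff_monomial]
  simp only [eq_comm]

theorem bgwModMass_succ (μ0 μ : ℕ → ℝ) (m : ℕ) :
    bgwModMass μ0 μ (m + 1) =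
      ∑ k ∈ Finset.range (m + 1), μ0 k * PowerSeries.coeff m (genF μ ^ k) := by
  simp only [coeff_genF_pow, Finset.mul_sum]
  rw [Finset.sum_sigma', bgwModMass_eq μ0 μ (le_refl (m + 1))]
  symm
  refine Finset.sum_bij (fun a _ => joinTree a.1 a.2) ?_ ?_ ?_ ?_
  · rintro ⟨k, f⟩ h
    simp only [Finset.mem_sigma, Finset.mem_range, Finset.mem_filter, Fintype.mem_piFinset,
      mem_treesLE] at h
    simp only [Finset.mem_filter, mem_treesLE, card_joinTree, h.2.2]
    simp
  · rintro ⟨k, f⟩ _ ⟨k', f'⟩ _ h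
    exact joinTree_inj h
  · intro τ hτ
    obtain ⟨f, hf⟩ := joinTree_surj τ
    have hc := card_joinTree _ f
    rw [hf] at hc
    have h1 := sum_card_ge f
    simp only [Finset.mem_filter, mem_treesLE] at hτ
    refine ⟨⟨_, f⟩, ?_, hf⟩
    simp only [Finset.mem_sigma, Finset.mem_range, Finset.mem_filter, Fintype.mem_piFinset,
      mem_treesLE]
    refine ⟨by omega, fun i => ?_, by omega⟩
    have := card_le_sum f i
    omega
  · rintro ⟨k, f⟩ _
    rw [bgwModW_joinTree]

theorem bgwModMass_zero (μ0 μ : ℕ → ℝ) : bgwModMass μ0 μ 0 = 0 := by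
  rw [bgwModMass_eq μ0 μ (le_refl 0)]
  apply Finset.sum_eq_zero
  intro τ hτ
  simp only [Finset.mem_filter] at hτ
  have := τ.card_pos
  omega

theorem genF_coeff_zero (μ : ℕ → ℝ) : PowerSeries.coeff 0 (genF μ) = 0 := by
  rw [genF, PowerSeries.coeff_mk, bgwModMass_zero]

theorem genF_X_dvd (μ : ℕ → ℝ) : (PowerSeries.X : PowerSeries ℝ) ∣ genF μ := by
  rw [PowerSeries.X_dvd_iff, ← PowerSeries.coeff_zero_eq_constantCoeff_apply, genF_coeff_zero]

theorem genF_pow_coeff_lt (μ : ℕ → ℝ) {m k : ℕ} (h : m < k) :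
    PowerSeries.coeff m (genF μ ^ k) = 0 :=
  PowerSeries.X_pow_dvd_iff.1 (pow_dvd_pow_of_dvd (genF_X_dvd μ) k) m h

theorem genF_pow_rec (μ : ℕ → ℝ) (m k : ℕ) :
    PowerSeries.coeff (m + 1) (genF μ ^ (k + 1)) =
      ∑ j ∈ Finset.range (m + 1), μ j * PowerSeries.coeff m (genF μ ^ (k + j)) := by
  rw [pow_succ, PowerSeries.coeff_mul, Finset.Nat.sum_antidiagonal_succ']
  simp only [genF_coeff_zero, mul_zero]
  simp only [pow_add, PowerSeries.coeff_mul, Finset.mul_sum]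
  rw [Finset.sum_comm, zero_add]
  refine Finset.sum_congr rfl fun p hp => ?_
  have hp' : p.1 + p.2 = m := Finset.HasAntidiagonal.mem_antidiagonal.1 hp
  have : PowerSeries.coeff (p.2 + 1) (genF μ) =
      ∑ j ∈ Finset.range (m + 1), μ j * PowerSeries.coeff p.2 (genF μ ^ j) := by
    rw [genF, PowerSeries.coeff_mk, bgwModMass_succ]
    refine Finset.sum_subset ?_ ?_
    · intro x; simp only [Finset.mem_range]; omega
    · intro x _ hx
      simp only [Finset.mem_range] at hx
      rw [genF_pow_coeff_lt μ (by omega), mul_zero]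
  rw [this, Finset.mul_sum]
  refine Finset.sum_congr rfl fun j _ => ?_
  ring

/-- The law of the sum of `m` independent variables of law `μ`. -/
def walkP (μ : ℕ → ℝ) (m j : ℕ) : ℝ := PowerSeries.coeff j (PowerSeries.mk μ ^ m)

theorem walkP_succ (μ : ℕ → ℝ) (m j : ℕ) :
    walkP μ (m + 1) j = ∑ i ∈ Finset.range (j + 1), μ i * walkP μ m (j - i) := by
  rw [walkP, pow_succ', PowerSeries.coeff_mul, Finset.Nat.sum_antidiagonal_eq_sum_range_succ_mk]
  simp [walkP]

theorem walkP_succ_mul (μ : ℕ → ℝ) (m j : ℕ) :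
    ((m : ℝ) + 1) * ∑ i ∈ Finset.range (j + 1), (i : ℝ) * μ i * walkP μ m (j - i) =
      j * walkP μ (m + 1) j := by
  have hX : ∀ (f : PowerSeries ℝ) (i : ℕ),
      PowerSeries.coeff i (PowerSeries.X * PowerSeries.derivative ℝ f) = i * PowerSeries.coeff i f := by
    intro f i
    cases i with
    | zero => simp
    | succ i =>
      rw [PowerSeries.coeff_succ_X_mul, PowerSeries.coeff_derivative]
      push_cast; ring
  have h := hX (PowerSeries.mk μ ^ (m + 1)) j
  rw [walkP, ← h, Derivation.leibniz_pow]
  have h2 : PowerSeries.X * ((m + 1) • (PowerSeries.mk μ ^ (m + 1 - 1) •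
      PowerSeries.derivative ℝ (PowerSeries.mk μ))) =
      ((m : ℝ) + 1) • ((PowerSeries.X * PowerSeries.derivative ℝ (PowerSeries.mk μ)) *
        PowerSeries.mk μ ^ m) := by
    rw [← Nat.cast_smul_eq_nsmul ℝ]
    push_cast
    simp only [smul_eq_mul, mul_smul_comm]
    congr 1; ring
  rw [h2, map_smul, PowerSeries.coeff_mul, Finset.Nat.sum_antidiagonal_eq_sum_range_succ_mk,
    smul_eq_mul]
  simp only [hX, PowerSeries.coeff_mk, walkP]

/-- Lagrange inversion (Kemperman formula). -/
theorem kemperman (μ : ℕ → ℝ) (m k : ℕ) (hk : k ≤ m + 1) :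
    ((m : ℝ) + 1) * PowerSeries.coeff (m + 1) (genF μ ^ k) = k * walkP μ (m + 1) (m + 1 - k) := by
  induction m generalizing k with
  | zero =>
    cases k with
    | zero => simp [PowerSeries.coeff_one]
    | succ k =>
      obtain rfl : k = 0 := by omega
      rw [genF_pow_rec]
      simp [walkP]
  | succ m ih =>
    cases k with
    | zero => simp [PowerSeries.coeff_one]
    | succ k =>
      rw [genF_pow_rec]
      have hk' : k ≤ m + 1 := by omega
      have e1 : m + 1 + 1 - (k + 1) = m + 1 - k := by omega
      rw [e1]
      have h1 : ((m : ℝ) + 1) * ∑ j ∈ Finset.range (m + 1 + 1),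
          μ j * PowerSeries.coeff (m + 1) (genF μ ^ (k + j)) =
          ∑ j ∈ Finset.range (m + 1 - k + 1), μ j * ((k + j) * walkP μ (m + 1) (m + 1 - k - j)) := by
        rw [Finset.mul_sum]
        symm
        have hs : Finset.range (m + 1 - k + 1) ⊆ Finset.range (m + 1 + 1) := by
          intro x; simp only [Finset.mem_range]; omega
        rw [← Finset.sum_subset hs]
        · refine Finset.sum_congr rfl fun j hj => ?_
          simp only [Finset.mem_range] at hj
          have := ih (k + j) (by omega)
          rw [mul_left_comm ((m : ℝ) + 1), this, Nat.sub_sub]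
          push_cast; ring
        · intro j _ hj
          simp only [Finset.mem_range] at hj
          rw [genF_pow_coeff_lt μ (by omega)]; simp
      have h2 := walkP_succ_mul μ (m + 1) (m + 1 - k)
      have h3 := walkP_succ μ (m + 1) (m + 1 - k)
      have h4 : ∑ j ∈ Finset.range (m + 1 - k + 1), μ j * (((k : ℝ) + j) * walkP μ (m + 1) (m + 1 - k - j))
          = k * walkP μ (m + 1 + 1) (m + 1 - k) +
            ∑ i ∈ Finset.range (m + 1 - k + 1), (i : ℝ) * μ i * walkP μ (m + 1) (m + 1 - k - i) := by
        rw [h3, Finset.mul_sum, ← Finset.sum_add_distrib]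
        refine Finset.sum_congr rfl fun j _ => ?_
        ring
      rw [h4] at h1
      have hm : ((m : ℝ) + 1) ≠ 0 := by positivity
      apply mul_left_cancel₀ hm
      rw [Nat.cast_sub hk'] at h2
      push_cast at h2 ⊢
      linear_combination ((m : ℝ) + 1 + 1) * h1 + h2

/-- The character `x ↦ e^{ix}`. -/
def eI (x : ℝ) : ℂ := Complex.exp (x * Complex.I)

theorem norm_eI (x : ℝ) : ‖eI x‖ = 1 := Complex.norm_exp_ofReal_mul_I x

theorem eI_add (x y : ℝ) : eI (x + y) = eI x * eI y := by
  unfold eI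
  rw [← Complex.exp_add]
  push_cast; ring_nf

theorem eI_zero : eI 0 = 1 := by simp [eI]

theorem eI_nat_mul (k : ℕ) (x : ℝ) : eI (k * x) = eI x ^ k := by
  unfold eI
  rw [← Complex.exp_nat_mul]
  push_cast; ring_nf

theorem continuous_eI : Continuous eI := by
  unfold eI; fun_prop

/-- The characteristic function of `μ`. -/
def cfun (μ : ℕ → ℝ) (θ : ℝ) : ℂ := ∑' k : ℕ, (μ k : ℂ) * eI (k * θ)

theorem walkP_nonneg (μ : ℕ → ℝ) (hnn : ∀ k, 0 ≤ μ k) (m j : ℕ) : 0 ≤ walkP μ m j := by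
  induction m generalizing j with
  | zero =>
    simp only [walkP, pow_zero, PowerSeries.coeff_one]
    split_ifs <;> norm_num
  | succ m ih =>
    rw [walkP_succ]
    exact Finset.sum_nonneg fun i _ => mul_nonneg (hnn i) (ih _)

theorem summable_mul_eI {p : ℕ → ℝ} (hp : Summable p) (hnn : ∀ k, 0 ≤ p k) (θ : ℝ) :
    Summable fun k : ℕ => ‖(p k : ℂ) * eI (k * θ)‖ := by
  convert hp using 2 with k
  rw [norm_mul, norm_eI, mul_one, Complex.norm_real, Real.norm_of_nonneg (hnn k)]

theorem walkP_mul_eI (μ : ℕ → ℝ) (m j : ℕ) (θ : ℝ) :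
    ∑ kl ∈ Finset.HasAntidiagonal.antidiagonal j, ((μ kl.1 : ℂ) * eI (kl.1 * θ)) *
      ((walkP μ m kl.2 : ℂ) * eI (kl.2 * θ)) = (walkP μ (m + 1) j : ℂ) * eI (j * θ) := by
  rw [walkP, pow_succ', PowerSeries.coeff_mul]
  push_cast
  rw [Finset.sum_mul]
  refine Finset.sum_congr rfl fun p hp => ?_
  have hp' : p.1 + p.2 = j := Finset.HasAntidiagonal.mem_antidiagonal.1 hp
  rw [← hp']
  push_cast
  rw [add_mul, eI_add, PowerSeries.coeff_mk, walkP]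
  ring

theorem walkP_hasSum (μ : ℕ → ℝ) (hnn : ∀ k, 0 ≤ μ k) (hs : Summable μ) (m : ℕ) :
    Summable (walkP μ m) ∧ ∀ θ : ℝ, ∑' j : ℕ, (walkP μ m j : ℂ) * eI (j * θ) = cfun μ θ ^ m := by
  induction m with
  | zero =>
    have h0 : ∀ j, j ≠ 0 → walkP μ 0 j = 0 := by
      intro j hj; simp [walkP, PowerSeries.coeff_one, hj]
    constructor
    · exact summable_of_ne_finset_zero (s := {0}) (fun j hj => h0 j (by simpa using hj))
    · intro θ
      rw [tsum_eq_single 0 (fun j hj => by rw [h0 j hj]; simp)]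
      simp [walkP, eI_zero]
  | succ m ih =>
    have hS := fun θ : ℝ => summable_norm_sum_mul_antidiagonal_of_summable_norm
      (summable_mul_eI hs hnn θ) (summable_mul_eI ih.1 (walkP_nonneg μ hnn m) θ)
    constructor
    · have := hS 0
      simp only [walkP_mul_eI] at this
      convert this using 2 with j
      rw [norm_mul, norm_eI, mul_one, Complex.norm_real, Real.norm_of_nonneg (walkP_nonneg μ hnn _ j)]
    · intro θ
      have := tsum_mul_tsum_eq_tsum_sum_antidiagonal_of_summable_norm
        (summable_mul_eI hs hnn θ) (summable_mul_eI ih.1 (walkP_nonneg μ hnn m) θ)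
      simp only [walkP_mul_eI] at this
      rw [← this, ih.2 θ, pow_succ']
      rfl

theorem integral_eI (a : ℤ) : ∫ θ in (-Real.pi)..Real.pi, eI (a * θ) =
    if a = 0 then 2 * (Real.pi : ℂ) else 0 := by
  split_ifs with h
  · subst h
    simp only [Int.cast_zero, zero_mul, eI_zero]
    rw [intervalIntegral.integral_const]
    rw [Complex.real_smul]; push_cast; ring
  · have hc : (a : ℂ) * Complex.I ≠ 0 := mul_ne_zero (by exact_mod_cast h) Complex.I_ne_zero
    have := integral_exp_mul_complex (a := -Real.pi) (b := Real.pi) hc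
    have e : ∀ θ : ℝ, eI (a * θ) = Complex.exp (a * Complex.I * θ) := by
      intro θ; unfold eI; push_cast; ring_nf
    simp only [e]
    rw [this]
    have : Complex.exp (a * Complex.I * (Real.pi : ℝ)) =
        Complex.exp (a * Complex.I * ((-Real.pi : ℝ) : ℂ)) := by
      rw [Complex.exp_eq_exp_iff_exists_int]
      exact ⟨a, by push_cast; ring⟩
    rw [this]; simp

theorem walkP_fourier (μ : ℕ → ℝ) (hnn : ∀ k, 0 ≤ μ k) (hs : Summable μ) (m j : ℕ) :
    ∫ θ in (-Real.pi)..Real.pi, cfun μ θ ^ m * eI (-(j * θ)) = 2 * Real.pi * walkP μ m j := by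
  obtain ⟨h1, h2⟩ := walkP_hasSum μ hnn hs m
  have key : HasSum (fun i : ℕ => ∫ θ in (-Real.pi)..Real.pi,
      (walkP μ m i : ℂ) * eI (i * θ) * eI (-(j * θ)))
      (∫ θ in (-Real.pi)..Real.pi, cfun μ θ ^ m * eI (-(j * θ))) := by
    refine intervalIntegral.hasSum_integral_of_dominated_convergence
      (fun i _ => walkP μ m i) ?_ ?_ ?_ ?_ ?_
    · intro i
      apply Continuous.aestronglyMeasurable
      have := continuous_eI
      fun_prop
    · intro i
      refine Eventually.of_forall fun t _ => ?_
      rw [norm_mul, norm_mul, norm_eI, norm_eI, mul_one, mul_one, Complex.norm_real,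
        Real.norm_of_nonneg (walkP_nonneg μ hnn m i)]
    · exact Eventually.of_forall fun t _ => h1
    · exact intervalIntegrable_const
    · refine Eventually.of_forall fun t _ => ?_
      rw [← h2 t]
      exact ((summable_mul_eI h1 (walkP_nonneg μ hnn m) t).of_norm.hasSum).mul_right _
  have e : ∀ i : ℕ, ∫ θ in (-Real.pi)..Real.pi,
      (walkP μ m i : ℂ) * eI (i * θ) * eI (-(j * θ)) =
      if i = j then 2 * Real.pi * (walkP μ m j : ℂ) else 0 := by
    intro i
    have : ∀ θ : ℝ, (walkP μ m i : ℂ) * eI (i * θ) * eI (-(j * θ)) =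
        (walkP μ m i : ℂ) * eI (((i - j : ℤ) : ℝ) * θ) := by
      intro θ
      rw [mul_assoc, ← eI_add]
      push_cast; ring_nf
    simp only [this]
    rw [intervalIntegral.integral_const_mul, integral_eI]
    by_cases hij : i = j
    · subst hij; simp; ring
    · have : (i : ℤ) - j ≠ 0 := by omega
      simp [hij, this]
  simp only [e] at key
  exact key.unique (hasSum_ite_eq j _)

theorem continuous_cfun (μ : ℕ → ℝ) (hnn : ∀ k, 0 ≤ μ k) (hs : Summable μ) :
    Continuous (cfun μ) := by
  refine continuous_tsum (u := μ) ?_ hs ?_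
  · intro i
    have := continuous_eI
    fun_prop
  · intro i x
    rw [norm_mul, norm_eI, mul_one, Complex.norm_real, Real.norm_of_nonneg (hnn i)]

theorem cfun_hasSum (μ : ℕ → ℝ) (hnn : ∀ k, 0 ≤ μ k) (hs : Summable μ) (θ : ℝ) :
    HasSum (fun k : ℕ => (μ k : ℂ) * eI (k * θ)) (cfun μ θ) :=
  (summable_mul_eI hs hnn θ).of_norm.hasSum

theorem eq_one_of_re {z : ℂ} (h : ‖z‖ = 1) (hr : z.re = 1) : z = 1 := by
  have := Complex.sq_norm z
  rw [Complex.normSq_apply, h, hr] at this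
  apply Complex.ext
  · simpa using hr
  · have : z.im * z.im = 0 := by linarith
    simpa using this

theorem cfun_norm_lt (μ : ℕ → ℝ) (hnn : ∀ k, 0 ≤ μ k) (hsum : HasSum μ 1) (hpos : 0 < μ 0)
    (haper : ∀ d : ℕ, (∀ i : ℕ, 0 < i → 0 < μ i → d ∣ i) → d = 1)
    (θ : ℝ) (hθ : |θ| ≤ Real.pi) (hθ0 : θ ≠ 0) : ‖cfun μ θ‖ < 1 := by
  by_contra hlt
  push Not at hlt
  have hn0 : (‖cfun μ θ‖ : ℂ) ≠ 0 := by
    have : ‖cfun μ θ‖ ≠ 0 := by linarith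
    exact_mod_cast this
  set w : ℂ := (starRingEnd ℂ) (cfun μ θ) / ‖cfun μ θ‖ with hw
  have hwn : ‖w‖ = 1 := by
    rw [hw, norm_div, RCLike.norm_conj, Complex.norm_real, norm_norm]
    exact div_self (by linarith)
  have hcw : cfun μ θ * w = (‖cfun μ θ‖ : ℂ) := by
    rw [hw, ← mul_div_assoc, Complex.mul_conj, Complex.normSq_eq_norm_sq]
    push_cast
    field_simp
  have h1 := (cfun_hasSum μ hnn hsum.summable θ).mul_right w
  rw [hcw] at h1
  have h2 := Complex.hasSum_re h1
  rw [Complex.ofReal_re] at h2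
  have e : ∀ k : ℕ, ((μ k : ℂ) * eI (k * θ) * w).re = μ k * (eI (k * θ) * w).re := by
    intro k; rw [mul_assoc, Complex.re_ofReal_mul]
  simp only [e] at h2
  have hnm : ∀ k : ℕ, ‖eI (k * θ) * w‖ = 1 := by
    intro k; rw [norm_mul, norm_eI, hwn, mul_one]
  have hle : ∀ k : ℕ, (eI (k * θ) * w).re ≤ 1 := by
    intro k
    calc _ ≤ ‖eI (k * θ) * w‖ := Complex.re_le_norm _
      _ = 1 := hnm k
  have h3 := hsum.sub h2
  have hnn3 : ∀ k : ℕ, 0 ≤ μ k - μ k * (eI (k * θ) * w).re := by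
    intro k
    nlinarith [hnn k, hle k]
  have h0 : 1 - ‖cfun μ θ‖ = 0 := le_antisymm (by linarith) (h3.nonneg hnn3)
  rw [h0, hasSum_zero_iff_of_nonneg hnn3] at h3
  have h4 : ∀ k : ℕ, 0 < μ k → eI (k * θ) * w = 1 := by
    intro k hk
    apply eq_one_of_re (hnm k)
    have := congrFun h3 k
    simp only [Pi.zero_apply] at this
    have h5 : μ k * (1 - (eI (k * θ) * w).re) = 0 := by linarith
    rcases mul_eq_zero.1 h5 with h | h
    · linarith
    · linarith
  have hw1 : w = 1 := by
    have := h4 0 hpos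
    simpa [eI_zero] using this
  have h5 := haper (orderOf (eI θ)) (by
    intro i _ hi
    have := h4 i hi
    rw [hw1, mul_one, eI_nat_mul] at this
    exact orderOf_dvd_of_pow_eq_one this)
  rw [orderOf_eq_one_iff] at h5
  unfold eI at h5
  rw [Complex.exp_eq_one_iff] at h5
  obtain ⟨n, hn⟩ := h5
  have hn2 : (θ : ℂ) = ((n * (2 * Real.pi) : ℝ) : ℂ) := by
    apply mul_right_cancel₀ Complex.I_ne_zero
    rw [hn]; push_cast; ring
  have hn3 : θ = n * (2 * Real.pi) := by exact_mod_cast hn2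
  have hn0' : n ≠ 0 := by
    rintro rfl
    apply hθ0; rw [hn3]; simp
  have : (1 : ℝ) ≤ |(n : ℝ)| := by exact_mod_cast Int.one_le_abs hn0'
  rw [hn3, abs_mul, abs_of_pos (by positivity : (0:ℝ) < 2 * Real.pi)] at hθ
  nlinarith [Real.pi_pos]

theorem eI_bound2 (x : ℝ) : ‖eI x - 1 - x * Complex.I‖ ≤ 3 * x ^ 2 := by
  have hx : ‖(x : ℂ) * Complex.I‖ = |x| := by simp
  by_cases h : |x| ≤ 1
  · have := Complex.norm_exp_sub_one_sub_id_le (x := x * Complex.I) (by rw [hx]; exact h)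
    rw [hx, sq_abs] at this
    unfold eI
    nlinarith [sq_nonneg x]
  · push Not at h
    calc ‖eI x - 1 - x * Complex.I‖ ≤ ‖eI x - 1‖ + ‖(x : ℂ) * Complex.I‖ := norm_sub_le _ _
      _ ≤ (‖eI x‖ + ‖(1 : ℂ)‖) + |x| := by rw [hx]; gcongr; exact norm_sub_le _ _
      _ = 2 + |x| := by rw [norm_eI, norm_one]; ring
      _ ≤ 3 * |x| ^ 2 := by nlinarith
      _ = 3 * x ^ 2 := by rw [sq_abs]

theorem eI_bound3 (x : ℝ) (h : |x| ≤ 1) :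
    ‖eI x - 1 - x * Complex.I + (x : ℂ) ^ 2 / 2‖ ≤ |x| ^ 3 := by
  have hx : ‖(x : ℂ) * Complex.I‖ = |x| := by simp
  have := Complex.exp_bound (x := x * Complex.I) (by rw [hx]; exact h) (n := 3) (by norm_num)
  rw [hx] at this
  have e : eI x - 1 - x * Complex.I + (x : ℂ) ^ 2 / 2 = Complex.exp (x * Complex.I) -
      ∑ m ∈ Finset.range 3, (x * Complex.I) ^ m / (m.factorial : ℂ) := by
    simp only [Finset.sum_range_succ, Finset.sum_range_zero, eI, mul_pow, Complex.I_sq]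
    norm_num [Nat.factorial]
    ring
  rw [e]
  refine this.trans ?_
  have : 0 ≤ |x| ^ 3 := by positivity
  norm_num [Nat.factorial]
  linarith

theorem eI_taylor_term (a : ℝ) :
    Tendsto (fun θ : ℝ => (eI (a * θ) - 1 - (a * θ : ℝ) * Complex.I) / (θ : ℂ) ^ 2)
      (nhdsWithin 0 {0}ᶜ) (nhds (-(a : ℂ) ^ 2 / 2)) := by
  rw [tendsto_iff_norm_sub_tendsto_zero]
  have hlim : Tendsto (fun θ : ℝ => |a| ^ 3 * |θ|) (nhdsWithin 0 {0}ᶜ) (nhds 0) := by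
    have : Tendsto (fun θ : ℝ => |a| ^ 3 * |θ|) (nhds 0) (nhds (|a| ^ 3 * |(0:ℝ)|)) := by
      apply Continuous.tendsto; fun_prop
    simp only [abs_zero, mul_zero] at this
    exact this.mono_left nhdsWithin_le_nhds
  refine squeeze_zero' (Eventually.of_forall fun _ => norm_nonneg _) ?_ hlim
  have hsmall : ∀ᶠ θ : ℝ in nhdsWithin 0 {0}ᶜ, |a * θ| < 1 := by
    have : Tendsto (fun θ : ℝ => |a * θ|) (nhds 0) (nhds (|a * (0:ℝ)|)) := by
      apply Continuous.tendsto; fun_prop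
    simp only [mul_zero, abs_zero] at this
    exact (this.mono_left nhdsWithin_le_nhds).eventually_lt_const one_pos
  filter_upwards [hsmall, self_mem_nhdsWithin] with θ h1 h2
  have h2' : θ ≠ 0 := h2
  have h2'' : (θ : ℂ) ≠ 0 := by exact_mod_cast h2'
  have e : (eI (a * θ) - 1 - (a * θ : ℝ) * Complex.I) / (θ : ℂ) ^ 2 - -(a : ℂ) ^ 2 / 2 =
      (eI (a * θ) - 1 - (a * θ : ℝ) * Complex.I + ((a * θ : ℝ) : ℂ) ^ 2 / 2) / (θ : ℂ) ^ 2 := by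
    push_cast
    field_simp
    ring
  rw [e, norm_div, norm_pow, Complex.norm_real, Real.norm_eq_abs, div_le_iff₀ (by positivity)]
  refine (eI_bound3 (a * θ) h1.le).trans (le_of_eq ?_)
  rw [abs_mul]; ring

theorem cfun_taylor (μ : ℕ → ℝ) (σ2 : ℝ) (hnn : ∀ k, 0 ≤ μ k) (hsum : HasSum μ 1)
    (hcrit : HasSum (fun k : ℕ => (k : ℝ) * μ k) 1)
    (hvar : HasSum (fun k : ℕ => (k : ℝ) ^ 2 * μ k) (σ2 + 1)) :
    Tendsto (fun θ : ℝ => (cfun μ θ * eI (-θ) - 1) / (θ : ℂ) ^ 2)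
      (nhdsWithin 0 {0}ᶜ) (nhds (-(σ2 : ℂ) / 2)) := by
  have hc2 : HasSum (fun k : ℕ => ((k : ℝ) - 1) ^ 2 * μ k) σ2 := by
    have := (hvar.sub (hcrit.mul_left 2)).add hsum
    rw [show σ2 + 1 - 2 * 1 + 1 = σ2 by ring] at this
    have e : (fun k : ℕ => ((k : ℝ) - 1) ^ 2 * μ k) =
        fun b : ℕ => (b : ℝ) ^ 2 * μ b - 2 * ((b : ℝ) * μ b) + μ b := by
      funext k; ring
    rw [e]; exact this
  have hc1 : HasSum (fun k : ℕ => ((k : ℝ) - 1) * μ k) 0 := by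
    have := hcrit.sub hsum
    rw [sub_self] at this
    have e : (fun k : ℕ => ((k : ℝ) - 1) * μ k) = fun b : ℕ => (b : ℝ) * μ b - μ b := by
      funext k; ring
    rw [e]; exact this
  have hlim : ∑' k : ℕ, (μ k : ℂ) * (-(((k : ℝ) - 1 : ℝ) : ℂ) ^ 2 / 2) = -(σ2 : ℂ) / 2 := by
    have := (Complex.hasSum_ofReal.2 hc2).mul_left (-1 / 2 : ℂ)
    rw [show -(σ2 : ℂ) / 2 = (-1 / 2 : ℂ) * σ2 by ring, ← this.tsum_eq]
    congr 1
    funext k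
    push_cast; ring
  rw [← hlim]
  have e : ∀ θ : ℝ, (cfun μ θ * eI (-θ) - 1) / (θ : ℂ) ^ 2 = ∑' k : ℕ, (μ k : ℂ) *
      ((eI (((k : ℝ) - 1) * θ) - 1 - ((((k : ℝ) - 1) * θ : ℝ) : ℂ) * Complex.I) / (θ : ℂ) ^ 2) := by
    intro θ
    have h1 := (cfun_hasSum μ hnn hsum.summable θ).mul_right (eI (-θ))
    have h2 := Complex.hasSum_ofReal.2 hsum
    have h3 := (Complex.hasSum_ofReal.2 hc1).mul_right ((θ : ℂ) * Complex.I)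
    have h4 := ((h1.sub h2).sub h3).div_const ((θ : ℂ) ^ 2)
    rw [Complex.ofReal_zero, zero_mul, sub_zero, Complex.ofReal_one] at h4
    rw [← h4.tsum_eq]
    congr 1
    funext k
    rw [mul_assoc, ← eI_add, show (k : ℝ) * θ + -θ = ((k : ℝ) - 1) * θ by ring]
    push_cast
    ring
  simp only [e]
  refine tendsto_tsum_of_dominated_convergence (bound := fun k : ℕ => 3 * (((k : ℝ) - 1) ^ 2 * μ k))
    (hc2.summable.mul_left 3) ?_ ?_
  · intro k
    exact (eI_taylor_term ((k : ℝ) - 1)).const_mul _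
  · filter_upwards [self_mem_nhdsWithin] with θ hθ k
    have h2' : θ ≠ 0 := hθ
    rw [norm_mul, Complex.norm_real, Real.norm_of_nonneg (hnn k), norm_div, norm_pow,
      Complex.norm_real, Real.norm_eq_abs, sq_abs]
    have h5 : ‖eI (((k : ℝ) - 1) * θ) - 1 - ((((k : ℝ) - 1) * θ : ℝ) : ℂ) * Complex.I‖ / θ ^ 2 ≤
        3 * ((k : ℝ) - 1) ^ 2 := by
      rw [div_le_iff₀ (by positivity)]
      refine (eI_bound2 _).trans (le_of_eq ?_)
      ring
    calc _ ≤ μ k * (3 * ((k : ℝ) - 1) ^ 2) := mul_le_mul_of_nonneg_left h5 (hnn k)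
      _ = _ := by ring

theorem cfun_norm_le (μ : ℕ → ℝ) (hnn : ∀ k, 0 ≤ μ k) (hsum : HasSum μ 1) (θ : ℝ) :
    ‖cfun μ θ‖ ≤ 1 := by
  refine tsum_of_norm_bounded hsum fun i => ?_
  rw [norm_mul, norm_eI, mul_one, Complex.norm_real, Real.norm_of_nonneg (hnn i)]

theorem cfun_gauss_bound (μ : ℕ → ℝ) (σ2 : ℝ) (hnn : ∀ k, 0 ≤ μ k) (hsum : HasSum μ 1)
    (hpos : 0 < μ 0)
    (hcrit : HasSum (fun k : ℕ => (k : ℝ) * μ k) 1)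
    (haper : ∀ d : ℕ, (∀ i : ℕ, 0 < i → 0 < μ i → d ∣ i) → d = 1)
    (hσ2 : 0 < σ2) (hvar : HasSum (fun k : ℕ => (k : ℝ) ^ 2 * μ k) (σ2 + 1)) :
    ∃ c : ℝ, 0 < c ∧ ∀ θ : ℝ, |θ| ≤ Real.pi → ‖cfun μ θ‖ ≤ Real.exp (-c * θ ^ 2) := by
  have hT := cfun_taylor μ σ2 hnn hsum hcrit hvar
  rw [Metric.tendsto_nhds] at hT
  have hT1 := hT (σ2 / 4) (by positivity)
  have hT2 : ∀ᶠ θ : ℝ in nhdsWithin 0 {0}ᶜ, σ2 * θ ^ 2 / 2 < 1 := by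
    have : Tendsto (fun θ : ℝ => σ2 * θ ^ 2 / 2) (nhds 0) (nhds (σ2 * (0:ℝ) ^ 2 / 2)) := by
      apply Continuous.tendsto; fun_prop
    simp only [ne_eq, OfNat.ofNat_ne_zero, not_false_eq_true, zero_pow, mul_zero, zero_div] at this
    exact (this.mono_left nhdsWithin_le_nhds).eventually_lt_const one_pos
  have hT3 := hT1.and hT2
  rw [eventually_nhdsWithin_iff, Metric.eventually_nhds_iff] at hT3
  obtain ⟨δ, hδ, hδ2⟩ := hT3
  have near : ∀ θ : ℝ, |θ| < δ → ‖cfun μ θ‖ ≤ Real.exp (-(σ2 / 4) * θ ^ 2) := by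
    intro θ hθ
    by_cases h0 : θ = 0
    · subst h0
      simpa using cfun_norm_le μ hnn hsum 0
    · obtain ⟨h1, h2⟩ := hδ2 (y := θ) (by simpa using hθ) h0
      rw [dist_eq_norm] at h1
      have h0' : (θ : ℂ) ≠ 0 := by exact_mod_cast h0
      have e : cfun μ θ * eI (-θ) = ((1 - σ2 * θ ^ 2 / 2 : ℝ) : ℂ) +
          ((cfun μ θ * eI (-θ) - 1) / (θ : ℂ) ^ 2 - -(σ2 : ℂ) / 2) * (θ : ℂ) ^ 2 := by
        push_cast
        field_simp
        ring
      have hn : ‖cfun μ θ‖ = ‖cfun μ θ * eI (-θ)‖ := by rw [norm_mul, norm_eI, mul_one]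
      rw [hn, e]
      have hθ2 : 0 < θ ^ 2 := by positivity
      calc _ ≤ ‖((1 - σ2 * θ ^ 2 / 2 : ℝ) : ℂ)‖ +
            ‖((cfun μ θ * eI (-θ) - 1) / (θ : ℂ) ^ 2 - -(σ2 : ℂ) / 2) * (θ : ℂ) ^ 2‖ := norm_add_le _ _
        _ ≤ (1 - σ2 * θ ^ 2 / 2) + (σ2 / 4) * θ ^ 2 := by
            gcongr
            · rw [Complex.norm_real, Real.norm_of_nonneg (by linarith)]
            · rw [norm_mul, norm_pow, Complex.norm_real, Real.norm_eq_abs, sq_abs]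
              gcongr
        _ = -(σ2 / 4) * θ ^ 2 + 1 := by ring
        _ ≤ _ := Real.add_one_le_exp _
  have hK : IsCompact ({θ : ℝ | δ ≤ |θ|} ∩ Set.Icc (-Real.pi) Real.pi) := by
    apply IsCompact.inter_left isCompact_Icc
    exact isClosed_le continuous_const continuous_abs
  have far : ∃ ρ : ℝ, ρ < 1 ∧ ∀ θ : ℝ, δ ≤ |θ| → |θ| ≤ Real.pi → ‖cfun μ θ‖ ≤ ρ := by
    rcases Set.eq_empty_or_nonempty ({θ : ℝ | δ ≤ |θ|} ∩ Set.Icc (-Real.pi) Real.pi) with hE | hE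
    · refine ⟨0, by norm_num, fun θ h1 h2 => ?_⟩
      exfalso
      have : θ ∈ ({θ : ℝ | δ ≤ |θ|} ∩ Set.Icc (-Real.pi) Real.pi) := ⟨h1, abs_le.1 h2⟩
      rw [hE] at this
      exact this
    · obtain ⟨x, hx, hmax⟩ := hK.exists_isMaxOn hE
        (continuous_cfun μ hnn hsum.summable).norm.continuousOn
      refine ⟨‖cfun μ x‖, ?_, fun θ h1 h2 => hmax ⟨h1, abs_le.1 h2⟩⟩
      apply cfun_norm_lt μ hnn hsum hpos haper x (abs_le.2 hx.2)
      have h1 : δ ≤ |x| := hx.1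
      intro h0
      rw [h0, abs_zero] at h1
      linarith
  obtain ⟨ρ, hρ, hfar⟩ := far
  have hpi := Real.pi_pos
  refine ⟨min (σ2 / 4) ((1 - ρ) / Real.pi ^ 2), lt_min (by positivity)
    (div_pos (by linarith) (by positivity)), fun θ hθ => ?_⟩
  by_cases h : |θ| < δ
  · refine (near θ h).trans ?_
    apply Real.exp_le_exp.2
    have := min_le_left (σ2 / 4) ((1 - ρ) / Real.pi ^ 2)
    nlinarith [sq_nonneg θ]
  · push Not at h
    refine (hfar θ h hθ).trans ?_
    have h1 := min_le_right (σ2 / 4) ((1 - ρ) / Real.pi ^ 2)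
    set c := min (σ2 / 4) ((1 - ρ) / Real.pi ^ 2)
    have h2 : θ ^ 2 ≤ Real.pi ^ 2 := by
      rw [← sq_abs]; gcongr
    have h3 : c * θ ^ 2 ≤ 1 - ρ := by
      calc c * θ ^ 2 ≤ ((1 - ρ) / Real.pi ^ 2) * θ ^ 2 := by gcongr
        _ ≤ ((1 - ρ) / Real.pi ^ 2) * Real.pi ^ 2 := by
            apply mul_le_mul_of_nonneg_left h2
            exact div_nonneg (by linarith) (by positivity)
        _ = 1 - ρ := by field_simp
    have := Real.add_one_le_exp (-c * θ ^ 2)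
    linarith

/-- The rescaled Fourier integrand. -/
def llF (μ : ℕ → ℝ) (m j : ℕ) (u : ℝ) : ℂ :=
  (Set.Ioc (-(Real.pi * Real.sqrt m)) (Real.pi * Real.sqrt m)).indicator
    (fun u => cfun μ (u / Real.sqrt m) ^ m * eI (-(j * (u / Real.sqrt m)))) u

theorem walkP_eq_integral (μ : ℕ → ℝ) (hnn : ∀ k, 0 ≤ μ k) (hs : Summable μ) (m j : ℕ) (hm : 0 < m) :
    ((2 * Real.pi * (Real.sqrt m * walkP μ m j) : ℝ) : ℂ) = ∫ u, llF μ m j u := by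
  have hsq : 0 < Real.sqrt m := Real.sqrt_pos.2 (by exact_mod_cast hm)
  have hpi := Real.pi_pos
  have h := walkP_fourier μ hnn hs m j
  have h2 := intervalIntegral.integral_comp_div (a := -(Real.pi * Real.sqrt m))
    (b := Real.pi * Real.sqrt m) (c := Real.sqrt m)
    (fun θ => cfun μ θ ^ m * eI (-(j * θ))) hsq.ne'
  rw [show -(Real.pi * Real.sqrt m) / Real.sqrt m = -Real.pi by field_simp,
    show Real.pi * Real.sqrt m / Real.sqrt m = Real.pi by field_simp, h,
    intervalIntegral.integral_of_le (by nlinarith),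
    ← MeasureTheory.integral_indicator measurableSet_Ioc] at h2
  unfold llF
  rw [h2, Complex.real_smul]
  push_cast
  ring

theorem llF_bound (μ : ℕ → ℝ) (c : ℝ)
    (hc : ∀ θ : ℝ, |θ| ≤ Real.pi → ‖cfun μ θ‖ ≤ Real.exp (-c * θ ^ 2)) (m j : ℕ) (u : ℝ) :
    ‖llF μ m j u‖ ≤ Real.exp (-c * u ^ 2) := by
  unfold llF
  by_cases hu : u ∈ Set.Ioc (-(Real.pi * Real.sqrt m)) (Real.pi * Real.sqrt m)
  · rw [Set.indicator_of_mem hu, norm_mul, norm_eI, mul_one, norm_pow]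
    have hpi := Real.pi_pos
    have hm : 0 < Real.sqrt m := by
      have := hu.1.trans_le hu.2
      by_contra h
      have h0 := Real.sqrt_nonneg m
      have : Real.sqrt m = 0 := by linarith
      rw [this] at hu
      simp at hu
    have h1 : |u / Real.sqrt m| ≤ Real.pi := by
      rw [abs_div, abs_of_pos hm, div_le_iff₀ hm]
      exact abs_le.2 ⟨hu.1.le, hu.2⟩
    calc ‖cfun μ (u / Real.sqrt m)‖ ^ m ≤ Real.exp (-c * (u / Real.sqrt m) ^ 2) ^ m := by
          gcongr; exact hc _ h1
      _ = Real.exp (-c * u ^ 2) := by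
          rw [← Real.exp_nat_mul, div_pow, Real.sq_sqrt (Nat.cast_nonneg m)]
          have : (m : ℝ) ≠ 0 := (Real.sqrt_pos.1 hm).ne'
          congr 1
          field_simp
  · rw [Set.indicator_of_notMem hu, norm_zero]
    positivity

theorem llF_measurable (μ : ℕ → ℝ) (hnn : ∀ k, 0 ≤ μ k) (hs : Summable μ) (m j : ℕ) :
    MeasureTheory.AEStronglyMeasurable (llF μ m j) MeasureTheory.volume := by
  unfold llF
  apply MeasureTheory.AEStronglyMeasurable.indicator _ measurableSet_Ioc
  apply Continuous.aestronglyMeasurable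
  have h1 := continuous_eI
  have h2 := continuous_cfun μ hnn hs
  fun_prop

theorem walkP_bound (μ : ℕ → ℝ) (hnn : ∀ k, 0 ≤ μ k) (hs : Summable μ) (c : ℝ) (hc0 : 0 < c)
    (hc : ∀ θ : ℝ, |θ| ≤ Real.pi → ‖cfun μ θ‖ ≤ Real.exp (-c * θ ^ 2)) (m j : ℕ) (hm : 0 < m) :
    Real.sqrt m * walkP μ m j ≤ ∫ u : ℝ, Real.exp (-c * u ^ 2) := by
  have h := MeasureTheory.norm_integral_le_of_norm_le (integrable_exp_neg_mul_sq hc0)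
    (Eventually.of_forall fun u => llF_bound μ c hc m j u)
  have h0 : 0 ≤ Real.sqrt m * walkP μ m j := mul_nonneg (Real.sqrt_nonneg _) (walkP_nonneg μ hnn m j)
  have hpi := Real.pi_gt_three
  rw [← walkP_eq_integral μ hnn hs m j hm, Complex.norm_real,
    Real.norm_of_nonneg (by positivity)] at h
  nlinarith

theorem sqrt_tendsto : Tendsto (fun m : ℕ => Real.sqrt m) atTop atTop :=
  Real.tendsto_sqrt_atTop.comp tendsto_natCast_atTop_atTop

theorem div_sqrt_tendsto (u : ℝ) : Tendsto (fun m : ℕ => u / Real.sqrt m) atTop (nhds 0) :=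
  sqrt_tendsto.const_div_atTop u

theorem llF_pointwise (μ : ℕ → ℝ) (σ2 : ℝ) (hnn : ∀ k, 0 ≤ μ k) (hsum : HasSum μ 1)
    (hcrit : HasSum (fun k : ℕ => (k : ℝ) * μ k) 1)
    (hvar : HasSum (fun k : ℕ => (k : ℝ) ^ 2 * μ k) (σ2 + 1)) (k : ℕ) (u : ℝ) :
    Tendsto (fun m : ℕ => llF μ m (m - k) u) atTop (nhds (Real.exp (-(σ2 / 2) * u ^ 2) : ℂ)) := by
  have hT := cfun_taylor μ σ2 hnn hsum hcrit hvar
  have h1 : Tendsto (fun m : ℕ => (m : ℂ) * (cfun μ (u / Real.sqrt m) * eI (-(u / Real.sqrt m)) - 1))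
      atTop (nhds (-(σ2 : ℂ) / 2 * (u : ℂ) ^ 2)) := by
    by_cases hu : u = 0
    · subst hu
      have : cfun μ 0 = 1 := by
        unfold cfun
        simp only [mul_zero, eI_zero, mul_one]
        have := (Complex.hasSum_ofReal.2 hsum).tsum_eq
        simpa using this
      simp [this, eI_zero]
    · have h2 : Tendsto (fun m : ℕ => u / Real.sqrt m) atTop (nhdsWithin 0 {0}ᶜ) := by
        rw [tendsto_nhdsWithin_iff]
        refine ⟨div_sqrt_tendsto u, ?_⟩
        filter_upwards [eventually_gt_atTop 0] with m hm
        have : 0 < Real.sqrt m := Real.sqrt_pos.2 (by exact_mod_cast hm)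
        exact div_ne_zero hu this.ne'
      refine ((hT.comp h2).mul_const ((u : ℂ) ^ 2)).congr' ?_
      filter_upwards [eventually_gt_atTop 0] with m hm
      have hm' : (m : ℂ) ≠ 0 := by exact_mod_cast hm.ne'
      have hu' : (u : ℂ) ≠ 0 := by exact_mod_cast hu
      have e : (((u / Real.sqrt m : ℝ)) : ℂ) ^ 2 = (u : ℂ) ^ 2 / m := by
        rw [← Complex.ofReal_pow, div_pow, Real.sq_sqrt (Nat.cast_nonneg m)]
        push_cast; rfl
      simp only [Function.comp_apply]
      rw [e]
      field_simp
  have h2 := Complex.tendsto_one_add_pow_exp_of_tendsto h1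
  have h3 : Tendsto (fun m : ℕ => eI (k * (u / Real.sqrt m))) atTop (nhds 1) := by
    have h4 : Tendsto (fun x : ℝ => eI (k * x)) (nhds 0) (nhds (eI (k * 0))) := by
      apply Continuous.tendsto
      have := continuous_eI
      fun_prop
    rw [mul_zero, eI_zero] at h4
    exact h4.comp (div_sqrt_tendsto u)
  have h5 := h2.mul h3
  rw [mul_one] at h5
  have e : Complex.exp (-(σ2 : ℂ) / 2 * (u : ℂ) ^ 2) = (Real.exp (-(σ2 / 2) * u ^ 2) : ℂ) := by
    push_cast; ring_nf
  rw [e] at h5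
  refine h5.congr' ?_
  have hlarge : ∀ᶠ m : ℕ in atTop, |u| < Real.pi * Real.sqrt m :=
    (sqrt_tendsto.const_mul_atTop Real.pi_pos).eventually_gt_atTop _
  filter_upwards [hlarge, eventually_ge_atTop k] with m hm hk
  have hmem : u ∈ Set.Ioc (-(Real.pi * Real.sqrt m)) (Real.pi * Real.sqrt m) := by
    rw [abs_lt] at hm
    exact ⟨hm.1, hm.2.le⟩
  unfold llF
  rw [Set.indicator_of_mem hmem, add_sub_cancel, mul_pow, ← eI_nat_mul, mul_assoc, ← eI_add,
    Nat.cast_sub hk]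
  congr 2
  ring

theorem local_limit (μ : ℕ → ℝ) (σ2 : ℝ) (hnn : ∀ k, 0 ≤ μ k) (hsum : HasSum μ 1)
    (hcrit : HasSum (fun k : ℕ => (k : ℝ) * μ k) 1)
    (hσ2 : 0 < σ2) (hvar : HasSum (fun k : ℕ => (k : ℝ) ^ 2 * μ k) (σ2 + 1))
    (c : ℝ) (hc0 : 0 < c)
    (hc : ∀ θ : ℝ, |θ| ≤ Real.pi → ‖cfun μ θ‖ ≤ Real.exp (-c * θ ^ 2)) (k : ℕ) :
    Tendsto (fun m : ℕ => Real.sqrt m * walkP μ m (m - k)) atTop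
      (nhds (1 / (Real.sqrt σ2 * Real.sqrt (2 * Real.pi)))) := by
  have h := MeasureTheory.tendsto_integral_of_dominated_convergence
    (fun u : ℝ => Real.exp (-c * u ^ 2))
    (fun m => llF_measurable μ hnn hsum.summable m (m - k)) (integrable_exp_neg_mul_sq hc0)
    (fun m => Eventually.of_forall fun u => llF_bound μ c hc m (m - k) u)
    (Eventually.of_forall fun u => llF_pointwise μ σ2 hnn hsum hcrit hvar k u)
  rw [integral_complex_ofReal, integral_gaussian] at h
  have h2 : Tendsto (fun m : ℕ => ((2 * Real.pi * (Real.sqrt m * walkP μ m (m - k)) : ℝ) : ℂ)) atTop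
      (nhds ((Real.sqrt (Real.pi / (σ2 / 2)) : ℝ) : ℂ)) := by
    refine h.congr' ?_
    filter_upwards [eventually_gt_atTop 0] with m hm
    rw [walkP_eq_integral μ hnn hsum.summable m (m - k) hm]
  have h3 := (Complex.continuous_re.tendsto _).comp h2
  simp only [Function.comp_def, Complex.ofReal_re] at h3
  have h4 := h3.const_mul (1 / (2 * Real.pi))
  have hpi := Real.pi_pos
  have e : 1 / (2 * Real.pi) * Real.sqrt (Real.pi / (σ2 / 2)) =
      1 / (Real.sqrt σ2 * Real.sqrt (2 * Real.pi)) := by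
    rw [show Real.pi / (σ2 / 2) = (2 * Real.pi) / σ2 by field_simp,
      Real.sqrt_div (by positivity)]
    have h5 : Real.sqrt (2 * Real.pi) ≠ 0 := (Real.sqrt_pos.2 (by positivity)).ne'
    have h6 : Real.sqrt σ2 ≠ 0 := (Real.sqrt_pos.2 hσ2).ne'
    have h7 : Real.sqrt (2 * Real.pi) ^ 2 = 2 * Real.pi := Real.sq_sqrt (by positivity)
    field_simp
    linear_combination h7
  rw [e] at h4
  refine h4.congr fun m => ?_
  field_simp

/-- Let `μ_∅` be a probability measure on `{1,2,…}` with finite mean `m₀`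
and `μ` a critical aperiodic probability measure on `ℤ₊` with finite variance `σ² > 0`. Then
`BGW^{μ_∅,μ}(T_n) ~ m₀/(σ sqrt(2π)) · n^{-3/2}` as `n → ∞`. -/
theorem bgwModMass_asymptotics (μ0 μ : ℕ → ℝ) (m0 σ2 : ℝ)
    (hμ0nn : ∀ k, 0 ≤ μ0 k) (hμ00 : μ0 0 = 0) (hμ0sum : HasSum μ0 1)
    (hμ0mean : HasSum (fun k : ℕ => (k : ℝ) * μ0 k) m0)
    (hμnn : ∀ k, 0 ≤ μ k) (hμsum : HasSum μ 1)
    (hμpos : 0 < μ 0) (hμ01 : μ 0 + μ 1 < 1)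
    (hcrit : HasSum (fun k : ℕ => (k : ℝ) * μ k) 1)
    (haper : ∀ d : ℕ, (∀ i : ℕ, 0 < i → 0 < μ i → d ∣ i) → d = 1)
    (hσ2 : 0 < σ2) (hvar : HasSum (fun k : ℕ => (k : ℝ) ^ 2 * μ k) (σ2 + 1)) :
    Tendsto (fun n : ℕ => bgwModMass μ0 μ n /
        (m0 / (Real.sqrt σ2 * Real.sqrt (2 * Real.pi)) * (n : ℝ) ^ (-(3 : ℝ) / 2)))
      atTop (nhds 1) := by
  obtain ⟨c, hc0, hc⟩ := cfun_gauss_bound μ σ2 hμnn hμsum hμpos hcrit haper hσ2 hvar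
  have hm0 : 1 ≤ m0 := by
    refine hasSum_le (fun k => ?_) hμ0sum hμ0mean
    rcases Nat.eq_zero_or_pos k with rfl | hk
    · rw [hμ00]; simp
    · have : (1 : ℝ) ≤ k := by exact_mod_cast hk
      nlinarith [hμ0nn k]
  set L : ℝ := 1 / (Real.sqrt σ2 * Real.sqrt (2 * Real.pi)) with hL
  have hLpos : 0 < L := by
    have := Real.pi_pos
    have h1 : 0 < Real.sqrt σ2 := Real.sqrt_pos.2 hσ2
    have h2 : 0 < Real.sqrt (2 * Real.pi) := Real.sqrt_pos.2 (by positivity)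
    positivity
  set C : ℝ := ∫ u : ℝ, Real.exp (-c * u ^ 2) with hC
  have hCnn : 0 ≤ C := MeasureTheory.integral_nonneg fun u => (Real.exp_pos _).le
  -- dominated convergence
  have hdom : Tendsto (fun m : ℕ => ∑' k : ℕ, if k ≤ m + 1 then
      ((k : ℝ) * μ0 k) * (Real.sqrt (m + 1 : ℕ) * walkP μ (m + 1) (m + 1 - k)) else 0) atTop
      (nhds (∑' k : ℕ, ((k : ℝ) * μ0 k) * L)) := by
    refine tendsto_tsum_of_dominated_convergence (bound := fun k : ℕ => ((k : ℝ) * μ0 k) * C)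
      (hμ0mean.summable.mul_right C) ?_ ?_
    · intro k
      have h1 := ((local_limit μ σ2 hμnn hμsum hcrit hσ2 hvar c hc0 hc k).comp
        (tendsto_add_atTop_nat 1)).const_mul ((k : ℝ) * μ0 k)
      refine h1.congr' ?_
      filter_upwards [eventually_ge_atTop k] with m hm
      rw [if_pos (by omega)]
      rfl
    · refine Eventually.of_forall fun m k => ?_
      have hkn : 0 ≤ (k : ℝ) * μ0 k := mul_nonneg (Nat.cast_nonneg k) (hμ0nn k)
      split_ifs with h
      · have h1 := walkP_bound μ hμnn hμsum.summable c hc0 hc (m + 1) (m + 1 - k) (by omega)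
        have h2 : 0 ≤ Real.sqrt (m + 1 : ℕ) * walkP μ (m + 1) (m + 1 - k) :=
          mul_nonneg (Real.sqrt_nonneg _) (walkP_nonneg μ hμnn _ _)
        rw [Real.norm_of_nonneg (mul_nonneg hkn h2)]
        exact mul_le_mul_of_nonneg_left h1 hkn
      · rw [norm_zero]; positivity
  rw [(hμ0mean.mul_right L).tsum_eq] at hdom
  have hmass : ∀ m : ℕ, (∑' k : ℕ, if k ≤ m + 1 then
      ((k : ℝ) * μ0 k) * (Real.sqrt (m + 1 : ℕ) * walkP μ (m + 1) (m + 1 - k)) else 0) =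
      Real.sqrt (m + 1 : ℕ) * ((m : ℝ) + 1) * bgwModMass μ0 μ (m + 2) := by
    intro m
    rw [bgwModMass_succ, Finset.mul_sum, tsum_eq_sum (s := Finset.range (m + 1 + 1))]
    · refine Finset.sum_congr rfl fun k hk => ?_
      simp only [Finset.mem_range] at hk
      rw [if_pos (by omega)]
      have := kemperman μ m k (by omega)
      linear_combination (-(Real.sqrt (m + 1 : ℕ) * μ0 k)) * this
    · intro k hk
      simp only [Finset.mem_range] at hk
      rw [if_neg (by omega)]
  simp only [hmass] at hdom
  rw [← tendsto_add_atTop_iff_nat 2]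
  -- the ratio of consecutive powers
  have hratio : Tendsto (fun m : ℕ => (((m : ℝ) + 2) / ((m : ℝ) + 1)) ^ ((3 : ℝ) / 2)) atTop
      (nhds 1) := by
    have h1 : Tendsto (fun m : ℕ => 1 + 1 / ((m : ℝ) + 1)) atTop (nhds (1 + 0)) :=
      tendsto_const_nhds.add tendsto_one_div_add_atTop_nhds_zero_nat
    rw [add_zero] at h1
    have h2 := h1.rpow_const (p := (3 : ℝ) / 2) (Or.inl one_ne_zero)
    rw [Real.one_rpow] at h2
    refine h2.congr fun m => ?_
    have : (m : ℝ) + 1 ≠ 0 := by positivity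
    congr 1
    field_simp
    ring
  have hfin := (hdom.mul hratio).div_const (m0 * L)
  have hne : m0 * L ≠ 0 := (mul_pos (by linarith) hLpos).ne'
  rw [mul_one, div_self hne] at hfin
  refine hfin.congr fun m => ?_
  have hp1 : (0 : ℝ) < (m : ℝ) + 1 := by positivity
  have hp2 : (0 : ℝ) < (m : ℝ) + 2 := by positivity
  have e1 : Real.sqrt (m + 1 : ℕ) * ((m : ℝ) + 1) = ((m : ℝ) + 1) ^ ((3 : ℝ) / 2) := by
    push_cast
    rw [Real.sqrt_eq_rpow, show (3 : ℝ) / 2 = 1 / 2 + 1 by norm_num, Real.rpow_add hp1,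
      Real.rpow_one]
  have e2 : (((m + 2 : ℕ) : ℝ)) ^ (-(3 : ℝ) / 2) = (((m : ℝ) + 2) ^ ((3 : ℝ) / 2))⁻¹ := by
    push_cast
    rw [show -(3 : ℝ) / 2 = -((3 : ℝ) / 2) by ring, Real.rpow_neg hp2.le]
  have e3 : m0 / (Real.sqrt σ2 * Real.sqrt (2 * Real.pi)) = m0 * L := by
    rw [hL]; ring
  rw [e1, e2, e3, Real.div_rpow hp2.le hp1.le]
  have q1 : ((m : ℝ) + 1) ^ ((3 : ℝ) / 2) ≠ 0 := (Real.rpow_pos_of_pos hp1 _).ne'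
  have q2 : ((m : ℝ) + 2) ^ ((3 : ℝ) / 2) ≠ 0 := (Real.rpow_pos_of_pos hp2 _).ne'
  have q3 : m0 ≠ 0 := by linarith
  field_simp

end
end
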